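/- Let k be a field, let p be an admissible Hilbert polynomial with Gotzmann partition b_1 ≥ b_2 ≥ … ≥ b_r ≥ 0, let c ≥ 1 be an integer, set n := c + b_1, and let s be the number of indices j with b_j = b_1. Then the lexicographic ideal L^p_n is the unique saturated Borel monomial ideal of k[x_0,…,x_n] with Hilbert polynomial p (i.e., every saturated Borel monomial ideal I ⊆ k[x_0,…,x_n] whose quotient has Hilbert polynomial p equals L^p_n) if and only if either (1) c ≥ 2 and (b_r > 0 or r ≤ 2), or (2) c = 1 and (b_r > 0, or b_1 = b_r, or r − s ≤ 2). -/

import Mathlib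

/-- The polynomial binomial coefficient `C(t+a, b) ∈ ℚ[t]`. -/
noncomputable def polyBinom (a b : ℤ) : Polynomial ℚ :=
  if 0 ≤ b then
    (Nat.factorial b.toNat : ℚ)⁻¹ •
      (descPochhammer ℚ b.toNat).comp (Polynomial.X + Polynomial.C (a : ℚ))
  else 0

/-- The Macaulay–Hartshorne expression `Σ_{i=0}^d [C(t+i, i+1) − C(t+i−e_i, i+1)]`. -/
noncomputable def mhSum (d : ℕ) (e : Fin (d + 1) → ℤ) : Polynomial ℚ :=
  ∑ i : Fin (d + 1),
    (polyBinom ((i : ℕ) : ℤ) (((i : ℕ) : ℤ) + 1) -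
      polyBinom (((i : ℕ) : ℤ) - e i) (((i : ℕ) : ℤ) + 1))

/-- A monomial ideal: an ideal generated by a set of monomials. -/
def IsMonomialIdeal {k : Type*} [Field k] {N : ℕ} (I : Ideal (MvPolynomial (Fin N) k)) : Prop :=
  ∃ S : Set (Fin N →₀ ℕ), I = Ideal.span ((fun u => MvPolynomial.monomial u (1 : k)) '' S)

/-- `I` is Borel (strongly stable): for every monomial `x^u ∈ I`, every `j` with
`x_j ∣ x^u`, and every `i < j`, the monomial `x^u·x_i/x_j` lies in `I`. -/
def IsBorel {k : Type*} [Field k] {N : ℕ} (I : Ideal (MvPolynomial (Fin N) k)) : Prop :=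
  ∀ u : Fin N →₀ ℕ, MvPolynomial.monomial u (1 : k) ∈ I →
    ∀ j : Fin N, u j ≠ 0 → ∀ i : Fin N, i < j →
      MvPolynomial.monomial (u - Finsupp.single j 1 + Finsupp.single i 1) (1 : k) ∈ I

/-- `I` is saturated with respect to the irrelevant ideal `⟨x_0,…,x_n⟩`: every `f` with
`f·⟨x_0,…,x_n⟩^j ⊆ I` for some `j ≥ 1` lies in `I`. -/
def IsSaturatedIdeal {k : Type*} [Field k] {N : ℕ} (I : Ideal (MvPolynomial (Fin N) k)) : Prop :=
  ∀ f : MvPolynomial (Fin N) k,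
    (∃ j : ℕ, 1 ≤ j ∧
      ∀ g ∈ (Ideal.span (Set.range (MvPolynomial.X : Fin N → MvPolynomial (Fin N) k))) ^ j,
        f * g ∈ I) → f ∈ I

/-- The Hilbert function of `k[x_0,…,x_{N−1}]/I` in degree `i`: the `k`-dimension of the
degree-`i` homogeneous piece modulo the degree-`i` part of `I`. -/
noncomputable def hilbFn {k : Type*} [Field k] {N : ℕ} (I : Ideal (MvPolynomial (Fin N) k))
    (i : ℕ) : ℕ :=
  Module.finrank k
    ((MvPolynomial.homogeneousSubmodule (Fin N) k i) ⧸
      (Submodule.comap (MvPolynomial.homogeneousSubmodule (Fin N) k i).subtype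
        (Submodule.restrictScalars k I)))

/-- The sequence `e_0, …, e_d` extended by `e_i := 0` for `i > d`. -/
def eExt (d : ℕ) (e : Fin (d + 1) → ℤ) (i : ℕ) : ℤ :=
  if h : i ≤ d then e ⟨i, Nat.lt_succ_of_le h⟩ else 0

/-- `a_j := e_j − e_{j+1}` for the extended sequence. -/
def aSeq (d : ℕ) (e : Fin (d + 1) → ℤ) (j : ℕ) : ℕ :=
  (eExt d e j - eExt d e (j + 1)).toNat

/-- The exponent vector of the `m`-th generator (for `0 ≤ m ≤ n−1`) of `L(a_0,…,a_{n−1})`: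
for `m < n−1` it is `x_0^{a_{n−1}}⋯x_{m−1}^{a_{n−m}}·x_m^{a_{n−1−m}+1}`, and for
`m = n−1` it is `x_0^{a_{n−1}}⋯x_{n−2}^{a_1}·x_{n−1}^{a_0}`. -/
noncomputable def lexExp (n : ℕ) (a : ℕ → ℕ) (m : ℕ) : Fin (n + 1) →₀ ℕ :=
  Finsupp.equivFunOnFinite.symm fun t : Fin (n + 1) =>
    if (t : ℕ) < m then a (n - 1 - (t : ℕ))
    else if (t : ℕ) = m then (if m = n - 1 then a 0 else a (n - 1 - m) + 1)
    else 0

/-- The monomial ideal `L(a_0,…,a_{n−1}) ⊆ k[x_0,…,x_n]`. -/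
noncomputable def lexIdealGen (k : Type*) [Field k] (n : ℕ) (a : ℕ → ℕ) :
    Ideal (MvPolynomial (Fin (n + 1)) k) :=
  Ideal.span ((fun m => MvPolynomial.monomial (lexExp n a m) (1 : k)) '' {m : ℕ | m < n})

/-- The polynomial `C(t + i - j, i)` contributed by the `j`-th entry of a Gotzmann partition when
that entry equals `i`. -/
noncomputable abbrev gotzmannTerm (i j : ℕ) : Polynomial ℚ := polyBinom ((i : ℤ) - (j : ℤ)) (i : ℤ)

lemma polyBinom_natCast (a : ℤ) (b : ℕ) : polyBinom a b = (Nat.factorial b : ℚ)⁻¹ •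
    (descPochhammer ℚ b).comp (Polynomial.X + Polynomial.C (a : ℚ)) := by
  simp [polyBinom]

lemma polyBinom_eval {t m b : ℕ} {a : ℤ} (h : (t : ℤ) + a = m) :
    (polyBinom a b).eval (t : ℚ) = m.choose b := by
  have h' : (t : ℚ) + (a : ℚ) = (m : ℚ) := by exact_mod_cast h
  rw [polyBinom_natCast, Polynomial.eval_smul, Polynomial.eval_comp, Polynomial.eval_add,
    Polynomial.eval_X, Polynomial.eval_C, h', descPochhammer_eval_eq_descFactorial,
    Nat.descFactorial_eq_factorial_mul_choose, smul_eq_mul]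
  push_cast
  exact inv_mul_cancel_left₀ (by positivity) _

lemma natDegree_polyBinom_le (a : ℤ) (b : ℕ) : (polyBinom a b).natDegree ≤ b := by
  rw [polyBinom_natCast]
  refine (Polynomial.natDegree_smul_le _ _).trans ?_
  rw [Polynomial.natDegree_comp, Polynomial.natDegree_X_add_C, descPochhammer_natDegree, mul_one]

lemma coeff_polyBinom (a : ℤ) (b : ℕ) : (polyBinom a b).coeff b = (Nat.factorial b : ℚ)⁻¹ := by
  have h : ((descPochhammer ℚ b).comp (Polynomial.X + Polynomial.C (a : ℚ))).natDegree = b := by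
    rw [Polynomial.natDegree_comp, Polynomial.natDegree_X_add_C, descPochhammer_natDegree, mul_one]
  have h1 : ((descPochhammer ℚ b).comp (Polynomial.X + Polynomial.C (a : ℚ))).Monic :=
    (monic_descPochhammer ℚ b).comp_X_add_C _
  have h2 := h1.coeff_natDegree
  rw [h] at h2
  rw [polyBinom_natCast, Polynomial.coeff_smul, h2, smul_eq_mul, mul_one]

lemma coeff_polyBinom_of_lt (a : ℤ) {b D : ℕ} (h : b < D) : (polyBinom a b).coeff D = 0 :=
  Polynomial.coeff_eq_zero_of_natDegree_lt ((natDegree_polyBinom_le a b).trans_lt h)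

lemma polyBinom_zero (a : ℤ) : polyBinom a 0 = 1 := by
  simpa using polyBinom_natCast a 0

lemma polynomial_eq_of_eventually_eval {p q : Polynomial ℚ} (N : ℕ)
    (h : ∀ t : ℕ, N ≤ t → p.eval (t : ℚ) = q.eval (t : ℚ)) : p = q := by
  refine Polynomial.eq_of_infinite_eval_eq p q (Set.Infinite.mono
    (s := (fun t : ℕ => (t : ℚ)) '' Set.Ici N) ?_ ?_)
  · rintro _ ⟨t, ht, rfl⟩
    exact h t ht
  · exact (Set.Ici_infinite N).image (Nat.cast_injective.injOn)

lemma polyBinom_pascal (a : ℤ) (b : ℕ) :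
    polyBinom (a + 1) ((b : ℤ) + 1) = polyBinom a ((b : ℤ) + 1) + polyBinom a b := by
  have hb : ((b : ℤ) + 1) = ((b + 1 : ℕ) : ℤ) := by push_cast; ring
  rw [hb]
  refine polynomial_eq_of_eventually_eval a.natAbs fun t ht => ?_
  obtain ⟨m, hm⟩ : ∃ m : ℕ, (t : ℤ) + a = m := ⟨((t : ℤ) + a).toNat, by omega⟩
  rw [Polynomial.eval_add, polyBinom_eval hm, polyBinom_eval hm,
    polyBinom_eval (m := m + 1) (by push_cast; omega), Nat.choose_succ_succ]
  push_cast
  ring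

lemma gotzmannTerm_succ (i j : ℕ) :
    gotzmannTerm (i + 1) j = gotzmannTerm (i + 1) (j + 1) + gotzmannTerm i j := by
  have h := polyBinom_pascal ((i : ℤ) - j) i
  simp only [gotzmannTerm]
  push_cast
  rw [show (i : ℤ) + 1 - j = i - j + 1 by ring, show (i : ℤ) + 1 - (j + 1) = i - j by ring, h]

lemma gotzmannTerm_eval {t i j : ℕ} (h : j ≤ t) :
    (gotzmannTerm i j).eval (t : ℚ) = (t - j + i).choose i :=
  polyBinom_eval (by omega)

lemma gotzmannTerm_eq_sum (b j : ℕ) :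
    gotzmannTerm b j = ∑ i ∈ Finset.range (b + 1), polyBinom ((i : ℤ) - 1 - j) i := by
  induction b with
  | zero => simp [gotzmannTerm, polyBinom_zero]
  | succ b ih =>
    rw [Finset.sum_range_succ, ← ih, gotzmannTerm_succ, add_comm]
    congr 1
    simp only [gotzmannTerm]
    congr 1
    push_cast
    ring

lemma polyBinom_sub_eq_sum (i e : ℕ) :
    polyBinom (i : ℤ) ((i : ℤ) + 1) - polyBinom ((i : ℤ) - e) ((i : ℤ) + 1)
      = ∑ k ∈ Finset.range e, polyBinom ((i : ℤ) - 1 - k) i := by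
  induction e with
  | zero => simp
  | succ e ih =>
    have h := polyBinom_pascal ((i : ℤ) - 1 - e) i
    rw [show (i : ℤ) - 1 - e + 1 = i - e by ring] at h
    rw [Finset.sum_range_succ, ← ih, h]
    push_cast
    rw [show (i : ℤ) - (e + 1) = i - 1 - e by ring]
    ring

lemma macaulay_sum_injective (D : ℕ) (e e' : ℕ → ℕ)
    (h : ∑ i ∈ Finset.range D, ∑ k ∈ Finset.range (e i), polyBinom ((i : ℤ) - 1 - k) i
      = ∑ i ∈ Finset.range D, ∑ k ∈ Finset.range (e' i), polyBinom ((i : ℤ) - 1 - k) i) :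
    ∀ i < D, e i = e' i := by
  induction D with
  | zero => simp
  | succ D ih =>
    have key : ∀ f : ℕ → ℕ, (∑ i ∈ Finset.range (D + 1), ∑ k ∈ Finset.range (f i),
        polyBinom ((i : ℤ) - 1 - k) i).coeff D = f D * (Nat.factorial D : ℚ)⁻¹ := by
      intro f
      rw [Finset.sum_range_succ, Polynomial.coeff_add, Polynomial.finsetSum_coeff,
        Finset.sum_eq_zero, Polynomial.finsetSum_coeff]
      · simp [coeff_polyBinom]
      · intro i hi
        rw [Polynomial.finsetSum_coeff]
        exact Finset.sum_eq_zero fun k _ => coeff_polyBinom_of_lt _ (Finset.mem_range.1 hi)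
    have hD : e D = e' D := by
      have h1 := congrArg (fun p => Polynomial.coeff p D) h
      simp only [key] at h1
      have h2 : (Nat.factorial D : ℚ)⁻¹ ≠ 0 := by positivity
      exact_mod_cast mul_right_cancel₀ h2 h1
    rw [Finset.sum_range_succ, Finset.sum_range_succ, hD] at h
    intro i hi
    rcases Nat.lt_succ_iff_lt_or_eq.1 hi with hi | rfl
    · exact ih (add_right_cancel h) i hi
    · exact hD

/-- The number of entries `≥ i` among `B 0, …, B (r - 1)`. -/
def countGE (B : ℕ → ℕ) (r i : ℕ) : ℕ := ((Finset.range r).filter fun j => i ≤ B j).card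

lemma lt_countGE_iff {B : ℕ → ℕ} (hB : Antitone B) {r i j : ℕ} :
    j < countGE B r i ↔ j < r ∧ i ≤ B j := by
  unfold countGE
  constructor
  · intro h
    by_contra hn
    have : ((Finset.range r).filter fun j => i ≤ B j) ⊆ Finset.range j := by
      intro x hx
      simp only [Finset.mem_filter, Finset.mem_range] at hx ⊢
      by_contra hjx
      exact hn ⟨by omega, hx.2.trans (hB (by omega))⟩
    have := Finset.card_le_card this
    rw [Finset.card_range] at this
    omega
  · rintro ⟨h1, h2⟩
    have : Finset.range (j + 1) ⊆ ((Finset.range r).filter fun j => i ≤ B j) := by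
      intro x hx
      simp only [Finset.mem_filter, Finset.mem_range] at hx ⊢
      exact ⟨by omega, h2.trans (hB (by omega))⟩
    have := Finset.card_le_card this
    rw [Finset.card_range] at this
    omega

lemma countGE_antitone (B : ℕ → ℕ) (r : ℕ) : Antitone (countGE B r) := fun _ _ h =>
  Finset.card_le_card fun _ hx => by
    simp only [Finset.mem_filter] at hx ⊢
    exact ⟨hx.1, h.trans hx.2⟩

lemma countGE_zero (B : ℕ → ℕ) (r : ℕ) : countGE B r 0 = r := by
  simp [countGE]

lemma countGE_eq_zero {B : ℕ → ℕ} (hB : Antitone B) {r i : ℕ} (h : B 0 < i) :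
    countGE B r i = 0 := by
  rw [countGE, Finset.card_eq_zero, Finset.filter_eq_empty_iff]
  intro j _
  have := hB (Nat.zero_le j)
  omega

lemma gotzmann_sum_eq_macaulay_sum {B : ℕ → ℕ} (hB : Antitone B) (r : ℕ) :
    ∑ j ∈ Finset.range r, gotzmannTerm (B j) j
      = ∑ i ∈ Finset.range (B 0 + 1), ∑ k ∈ Finset.range (countGE B r i),
          polyBinom ((i : ℤ) - 1 - k) i := by
  simp_rw [gotzmannTerm_eq_sum]
  refine Finset.sum_comm' fun j i => ?_
  simp only [Finset.mem_range, lt_countGE_iff hB]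
  have := hB (Nat.zero_le j)
  omega

lemma gotzmann_sum_eq_block_sum {B : ℕ → ℕ} (hB : Antitone B) {r D : ℕ} (hD : B 0 ≤ D) :
    ∑ j ∈ Finset.range r, gotzmannTerm (B j) j
      = ∑ i ∈ Finset.range (D + 1), ∑ j ∈ Finset.Ico (countGE B r (i + 1)) (countGE B r i),
          gotzmannTerm i j := by
  rw [← Finset.sum_fiberwise_of_maps_to (s := Finset.range r) (t := Finset.range (D + 1)) (g := B)]
  · refine Finset.sum_congr rfl fun i _ => Finset.sum_congr ?_ ?_
    · ext j
      have h1 := lt_countGE_iff hB (r := r) (i := i) (j := j)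
      have h2 := lt_countGE_iff hB (r := r) (i := i + 1) (j := j)
      simp only [Finset.mem_filter, Finset.mem_range, Finset.mem_Ico]
      omega
    · intro j hj
      rw [Finset.mem_Ico, ← not_lt, lt_countGE_iff hB, lt_countGE_iff hB] at hj
      rw [show B j = i by omega]
  · intro j _
    have := hB (Nat.zero_le j)
    rw [Finset.mem_range]
    omega

/-- The `k`-th entry of `L` is at most `q + k`. -/
def SlowFrom (q : ℕ) (L : List ℕ) : Prop := ∀ k, ∀ h : k < L.length, L[k] ≤ q + k

lemma SlowFrom.mono {q q' : ℕ} {L : List ℕ} (h : SlowFrom q L) (hq : q ≤ q') : SlowFrom q' L :=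
  fun k hk => (h k hk).trans (by omega)

lemma SlowFrom.append {q : ℕ} {U L : List ℕ} (hU : ∀ u ∈ U, u ≤ q) (h : SlowFrom q L) :
    SlowFrom q (U ++ L) := by
  intro k hk
  by_cases hkU : k < U.length
  · rw [List.getElem_append_left hkU]
    exact (hU _ (List.getElem_mem hkU)).trans (by omega)
  · rw [List.getElem_append_right (by omega)]
    refine (h _ _).trans (by omega)

lemma sum_map_range' (D x m : ℕ) : ((List.range' x m).map (gotzmannTerm D)).sum
    + gotzmannTerm (D + 1) (x + m) = gotzmannTerm (D + 1) x := by
  induction m with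
  | zero => simp
  | succ m ih =>
    rw [List.range'_concat, List.map_append, List.sum_append, ← ih,
      gotzmannTerm_succ D (x + m)]
    simp only [List.map_cons, List.map_nil, List.sum_singleton, one_mul]
    rw [← add_assoc x m 1]
    ring

lemma SlowFrom.exists_rewrite (D : ℕ) : ∀ (L : List ℕ) (q : ℕ), SlowFrom q L →
    ∃ U : List ℕ, (∀ u ∈ U, u < q + L.length) ∧
      (L.map (gotzmannTerm (D + 1))).sum
        = ∑ j ∈ Finset.Ico q (q + L.length), gotzmannTerm (D + 1) j
          + (U.map (gotzmannTerm D)).sum ∧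
      (U = [] ↔ L = List.range' q L.length) := by
  intro L
  induction L with
  | nil => exact fun q _ => ⟨[], by simp⟩
  | cons x L ih =>
    intro q h
    have hx : x ≤ q := h 0 (by simp)
    obtain ⟨U, hU1, hU2, hU3⟩ := ih (q + 1) fun k hk => by
      have := h (k + 1) (by simpa using hk)
      simp only [List.getElem_cons_succ] at this
      omega
    refine ⟨List.range' x (q - x) ++ U, ?_, ?_, ?_⟩
    · intro u hu
      rw [List.length_cons]
      rcases List.mem_append.1 hu with hu | hu
      · rw [List.mem_range'_1] at hu
        omega
      · have := hU1 u hu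
        omega
    · rw [List.map_cons, List.sum_cons, hU2, List.map_append, List.sum_append, List.length_cons,
        Finset.sum_eq_sum_Ico_succ_bot (by omega : q < q + (L.length + 1)),
        ← sum_map_range' D x (q - x), show x + (q - x) = q by omega,
        show q + 1 + L.length = q + (L.length + 1) by omega]
      ring
    · rw [List.append_eq_nil_iff, hU3, List.range'_eq_nil_iff, List.length_cons,
        List.range'_succ, List.cons.injEq]
      exact and_congr_left' (by omega)

lemma coeff_map_gotzmannTerm_sum (L : List ℕ) (D : ℕ) :
    (L.map (gotzmannTerm D)).sum.coeff D = L.length * (Nat.factorial D : ℚ)⁻¹ := by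
  induction L with
  | nil => simp
  | cons x L ih =>
    rw [List.map_cons, List.sum_cons, Polynomial.coeff_add, ih, coeff_polyBinom, List.length_cons]
    push_cast
    ring

lemma coeff_map_gotzmannTerm_sum_of_lt (L : List ℕ) {i D : ℕ} (h : i < D) :
    (L.map (gotzmannTerm i)).sum.coeff D = 0 := by
  induction L with
  | nil => simp
  | cons x L ih =>
    rw [List.map_cons, List.sum_cons, Polynomial.coeff_add, ih, coeff_polyBinom_of_lt _ h, add_zero]

lemma length_eq_of_gotzmann_sum_eq {f : ℕ → List ℕ} {E : ℕ → ℕ} {D : ℕ}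
    (h : ∑ i ∈ Finset.range (D + 1), ((f i).map (gotzmannTerm i)).sum
      = ∑ i ∈ Finset.range (D + 1), ∑ j ∈ Finset.Ico (E (i + 1)) (E i), gotzmannTerm i j) :
    (f D).length = E D - E (D + 1) := by
  have h1 := congrArg (fun p => Polynomial.coeff p D) h
  simp only [Finset.sum_range_succ, Polynomial.coeff_add, Polynomial.finsetSum_coeff] at h1
  rw [Finset.sum_eq_zero fun i hi => coeff_map_gotzmannTerm_sum_of_lt _ (Finset.mem_range.1 hi),
    Finset.sum_eq_zero fun i hi => Finset.sum_eq_zero fun j _ =>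
      coeff_polyBinom_of_lt _ (Finset.mem_range.1 hi), coeff_map_gotzmannTerm_sum] at h1
  simp only [coeff_polyBinom, Finset.sum_const, Nat.card_Ico, nsmul_eq_mul, zero_add] at h1
  have h2 : (Nat.factorial D : ℚ)⁻¹ ≠ 0 := by positivity
  exact_mod_cast mul_right_cancel₀ h2 h1

/-- Comparison of a sum of binomial polynomials with "slow" degree shifts to a Gotzmann sum. -/
theorem slow_sum_comparison (E : ℕ → ℕ) (hE : Antitone E) (D : ℕ) : ∀ f : ℕ → List ℕ,
    (∀ i ≤ D, SlowFrom (E (D + 1) + ∑ i' ∈ Finset.Ioc i D, (f i').length) (f i)) →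
    ∑ i ∈ Finset.range (D + 1), ((f i).map (gotzmannTerm i)).sum
      = ∑ i ∈ Finset.range (D + 1), ∑ j ∈ Finset.Ico (E (i + 1)) (E i), gotzmannTerm i j →
    E (D + 1) + ∑ i ∈ Finset.range (D + 1), (f i).length ≤ E 0 ∧
    ((E 0 = E 1 ∨ ∀ i ≤ D, f i = List.range' (E (D + 1) + ∑ i' ∈ Finset.Ioc i D, (f i').length)
        (f i).length) →
      ∀ i ≤ D, f i = List.range' (E (i + 1)) (E i - E (i + 1))) := by
  induction D with
  | zero =>
    intro f _ h
    have hlen := length_eq_of_gotzmann_sum_eq h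
    have h01 := hE (Nat.zero_le 1)
    refine ⟨by simp [hlen]; omega, ?_⟩
    rintro (h0 | h0) i hi
    · obtain rfl : i = 0 := by omega
      have : f 0 = [] := List.length_eq_zero_iff.1 (by simpa [h0] using hlen)
      simp [this, h0]
    · obtain rfl : i = 0 := by omega
      have := h0 0 le_rfl
      rw [hlen] at this
      simpa using this
  | succ D ih =>
    intro f hf h
    have hlen := length_eq_of_gotzmann_sum_eq h
    have hED := hE (Nat.le_succ (D + 1))
    simp only [Nat.succ_eq_add_one] at hED
    obtain ⟨U, hU1, hU2, hU3⟩ := (hf (D + 1) le_rfl).exists_rewrite D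
    simp only [Finset.Ioc_self, Finset.sum_empty, add_zero] at hU1 hU2 hU3
    have hq : E (D + 1 + 1) + (f (D + 1)).length = E (D + 1) := by omega
    rw [hq] at hU1 hU2
    set f' := Function.update f D (U ++ f D) with hf'
    have hf'D : f' D = U ++ f D := by simp [hf']
    have hf'ne : ∀ i, i ≠ D → f' i = f i := fun i hi => by simp [hf', hi]
    have htail : ∀ i ≤ D, E (D + 1 + 1) + ∑ i' ∈ Finset.Ioc i (D + 1), (f i').length
        = E (D + 1) + ∑ i' ∈ Finset.Ioc i D, (f i').length := by
      intro i hi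
      rw [← Finset.sum_Ioc_consecutive _ hi (Nat.le_succ D), Nat.succ_eq_add_one,
        Nat.Ioc_succ_singleton, Finset.sum_singleton]
      omega
    have hmono : ∀ i, ∑ i' ∈ Finset.Ioc i D, (f i').length
        ≤ ∑ i' ∈ Finset.Ioc i D, (f' i').length := by
      refine fun i => Finset.sum_le_sum fun i' _ => ?_
      by_cases h : i' = D
      · subst h
        simp [hf'D]
      · rw [hf'ne _ h]
    have hgood : ∀ i ≤ D,
        SlowFrom (E (D + 1) + ∑ i' ∈ Finset.Ioc i D, (f' i').length) (f' i) := by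
      intro i hi
      have h1 := hf i (by omega)
      rw [htail i hi] at h1
      have h2 := h1.mono (Nat.add_le_add_left (hmono i) (E (D + 1)))
      by_cases h : i = D
      · subst h
        rw [hf'D]
        exact h2.append fun u hu => (hU1 u hu).le.trans (Nat.le_add_right _ _)
      · rwa [hf'ne _ h]
    have hsum : ∑ i ∈ Finset.range (D + 1), ((f' i).map (gotzmannTerm i)).sum
        = ∑ i ∈ Finset.range (D + 1), ∑ j ∈ Finset.Ico (E (i + 1)) (E i), gotzmannTerm i j := by
      rw [Finset.sum_range_succ _ (D + 1), Finset.sum_range_succ _ (D + 1), hU2] at h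
      rw [Finset.sum_range_succ] at h ⊢
      rw [Finset.sum_congr rfl fun i hi => by
        rw [hf'ne i (by rw [Finset.mem_range] at hi; omega)], hf'D, List.map_append,
        List.sum_append]
      linear_combination h
    obtain ⟨h1, h2⟩ := ih f' hgood hsum
    constructor
    · refine le_trans ?_ h1
      rw [Finset.sum_range_succ _ (D + 1), Finset.sum_range_succ _ D, Finset.sum_range_succ _ D,
        Finset.sum_congr rfl fun i hi => by
          rw [← hf'ne i (by rw [Finset.mem_range] at hi; omega)], hf'D, List.length_append]
      omega
    · intro hcond
      have hUnil : U = [] := by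
        rcases hcond with h0 | h0
        · have h3 := h2 (Or.inl h0) D le_rfl
          rw [hf'D] at h3
          by_contra hne
          obtain ⟨u, hu⟩ := List.exists_mem_of_ne_nil U hne
          have h4 : u ∈ U ++ f D := List.mem_append_left _ hu
          rw [h3, List.mem_range'_1] at h4
          have := hU1 u hu
          omega
        · rw [hU3]
          simpa using h0 (D + 1) le_rfl
      have hff : f' = f := by simp [hf', hUnil]
      intro i hi
      rcases Nat.le_succ_iff.1 hi with hi | rfl
      · rw [← hff]
        refine h2 (hcond.imp_right fun h0 i hi => ?_) i hi
        rw [hff, ← htail i hi]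
        exact h0 i (by omega)
      · rw [← hlen]
        exact hU3.1 hUnil

/-- The set of exponents of monomials in a saturated Borel ideal of `k[x_0,…,x_n]`. -/
structure IsSatBorelSet {n : ℕ} (S : Set (Fin (n + 1) →₀ ℕ)) : Prop where
  add_mem : ∀ u ∈ S, ∀ w, u + w ∈ S
  borel : ∀ u, ∀ i j : Fin (n + 1), i < j → u + Finsupp.single j 1 ∈ S →
    u + Finsupp.single i 1 ∈ S
  sat : ∀ u, u + Finsupp.single (Fin.last n) 1 ∈ S → u ∈ S

/-- The least index `i` such that no `u + v e_i` lies in `S`. -/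
noncomputable def cod {n : ℕ} (S : Set (Fin (n + 1) →₀ ℕ)) (u : Fin (n + 1) →₀ ℕ) : ℕ :=
  sInf {i : ℕ | ∀ h : i < n + 1, ∀ v : ℕ, u + Finsupp.single ⟨i, h⟩ v ∉ S}

/-- The exponents outside `S` only involving variables of index `< cod S m`: these are the apices of
the cones in the Stanley decomposition of the complement of `S`. -/
def apices {n : ℕ} (S : Set (Fin (n + 1) →₀ ℕ)) : Set (Fin (n + 1) →₀ ℕ) :=
  {m | m ∉ S ∧ ∀ a, m a ≠ 0 → (a : ℕ) < cod S m}

/-- The number of exponents of degree `t` outside `S`. -/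
noncomputable def complCount {n : ℕ} (S : Set (Fin (n + 1) →₀ ℕ)) (t : ℕ) : ℕ := by
  classical exact ((Finset.univ.finsuppAntidiag t).filter (· ∉ S)).card

lemma mem_finsuppAntidiag_univ {n t : ℕ} {u : Fin (n + 1) →₀ ℕ} :
    u ∈ (Finset.univ : Finset (Fin (n + 1))).finsuppAntidiag t ↔ u.degree = t := by
  simp [Finsupp.degree_eq_sum]

lemma filter_lt_apply {n : ℕ} (u : Fin (n + 1) →₀ ℕ) {c : ℕ} {a : Fin (n + 1)} (ha : (a : ℕ) < c) :
    (u.filter fun a : Fin (n + 1) => (a : ℕ) < c) a = u a := by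
  rw [Finsupp.filter_apply, if_pos ha]

lemma filter_lt_apply_of_le {n : ℕ} (u : Fin (n + 1) →₀ ℕ) {c : ℕ} {a : Fin (n + 1)}
    (ha : ¬ (a : ℕ) < c) : (u.filter fun a : Fin (n + 1) => (a : ℕ) < c) a = 0 := by
  rw [Finsupp.filter_apply, if_neg ha]

lemma le_of_filter_not_lt_ne_zero {n : ℕ} {u : Fin (n + 1) →₀ ℕ} {c : ℕ} {a : Fin (n + 1)}
    (ha : (u.filter fun a : Fin (n + 1) => ¬ (a : ℕ) < c) a ≠ 0) : c ≤ (a : ℕ) := by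
  by_contra h
  rw [Finsupp.filter_apply, if_neg (by omega)] at ha
  exact ha rfl

namespace IsSatBorelSet

variable {n : ℕ} {S : Set (Fin (n + 1) →₀ ℕ)}

lemma move_single (hS : IsSatBorelSet S) {i j : Fin (n + 1)} (hij : i ≤ j) (v : ℕ) :
    ∀ u, u + Finsupp.single j v ∈ S → u + Finsupp.single i v ∈ S := by
  rcases hij.eq_or_lt with rfl | hij
  · exact fun _ => id
  induction v with
  | zero => simp
  | succ v ih =>
    intro u hu
    rw [Finsupp.single_add, ← add_assoc] at hu ⊢
    have h1 := hS.borel _ i j hij hu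
    rw [add_right_comm] at h1 ⊢
    exact ih _ h1

lemma collect (hS : IsSatBorelSet S) (i : Fin (n + 1)) (w : Fin (n + 1) →₀ ℕ) :
    (∀ a, w a ≠ 0 → i ≤ a) → ∀ u, u + w ∈ S → u + Finsupp.single i w.degree ∈ S := by
  induction w using Finsupp.induction_linear with
  | zero => simp
  | add f g hf hg =>
    intro h u hu
    rw [map_add, Finsupp.single_add]
    rw [add_comm f g, ← add_assoc] at hu
    have h1 := hf (fun a ha => h a (by simp [ha])) _ hu
    rw [add_right_comm] at h1
    have h2 := hg (fun a ha => h a (by simp [ha])) _ h1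
    rwa [add_assoc] at h2
  | single a b =>
    intro h u hu
    rw [Finsupp.degree_single]
    rcases eq_or_ne b 0 with rfl | hb
    · simpa using hu
    · exact hS.move_single (h a (by simpa using hb)) b u hu

lemma spread (hS : IsSatBorelSet S) (i : Fin (n + 1)) (w : Fin (n + 1) →₀ ℕ) :
    (∀ a, w a ≠ 0 → a ≤ i) → ∀ u, u + Finsupp.single i w.degree ∈ S → u + w ∈ S := by
  induction w using Finsupp.induction_linear with
  | zero => simp
  | add f g hf hg =>
    intro h u hu
    rw [map_add, Finsupp.single_add, ← add_assoc] at hu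
    have h1 := hg (fun a ha => h a (by simp [ha])) _ hu
    rw [add_right_comm] at h1
    have h2 := hf (fun a ha => h a (by simp [ha])) _ h1
    rwa [add_assoc, add_comm g f] at h2
  | single a b =>
    intro h u hu
    rw [Finsupp.degree_single] at hu
    rcases eq_or_ne b 0 with rfl | hb
    · simpa using hu
    · exact hS.move_single (h a (by simpa using hb)) b u hu

lemma mem_of_le (hS : IsSatBorelSet S) {u w : Fin (n + 1) →₀ ℕ} (hu : u ∈ S) (h : u ≤ w) :
    w ∈ S := by
  obtain ⟨c, rfl⟩ := exists_add_of_le h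
  exact hS.add_mem u hu c

lemma lt_cod_iff (hS : IsSatBorelSet S) (u : Fin (n + 1) →₀ ℕ) (i : Fin (n + 1)) :
    (i : ℕ) < cod S u ↔ ∃ v : ℕ, u + Finsupp.single i v ∈ S := by
  constructor
  · intro h
    have := Nat.notMem_of_lt_sInf h
    simp only [Set.mem_ofPred_eq, not_forall, not_not] at this
    obtain ⟨_, v, hv⟩ := this
    exact ⟨v, hv⟩
  · rintro ⟨v, hv⟩
    by_contra hlt
    have hmem : cod S u ∈ {i : ℕ | ∀ h : i < n + 1, ∀ v : ℕ, u + Finsupp.single ⟨i, h⟩ v ∉ S} :=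
      Nat.sInf_mem ⟨n + 1, fun h => absurd h (lt_irrefl _)⟩
    have hi := i.2
    exact hmem (by omega) v (hS.move_single (j := i) (by rw [Fin.le_def]; simpa using hlt) v u hv)

lemma cod_le_succ (u : Fin (n + 1) →₀ ℕ) : cod S u ≤ n + 1 :=
  Nat.sInf_le fun h => absurd h (lt_irrefl _)

lemma cod_le_iff (hS : IsSatBorelSet S) {u : Fin (n + 1) →₀ ℕ} : cod S u ≤ n ↔ u ∉ S := by
  have h := hS.lt_cod_iff u (Fin.last n)
  rw [Fin.val_last] at h
  rw [← not_lt, h, not_iff_not]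
  constructor
  · rintro ⟨v, hv⟩
    induction v with
    | zero => simpa using hv
    | succ v ih =>
      rw [Finsupp.single_add, ← add_assoc] at hv
      exact ih (hS.sat _ hv)
  · exact fun hu => ⟨0, by simpa using hu⟩

lemma cod_mono (hS : IsSatBorelSet S) {u w : Fin (n + 1) →₀ ℕ} (h : u ≤ w) :
    cod S u ≤ cod S w := by
  by_contra! hlt
  have hle := cod_le_succ (S := S) u
  have h1 := (hS.lt_cod_iff u ⟨cod S w, by omega⟩).1 hlt
  obtain ⟨v, hv⟩ := h1
  exact lt_irrefl _ ((hS.lt_cod_iff w ⟨cod S w, by omega⟩).2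
    ⟨v, hS.mem_of_le hv (add_le_add_left h _)⟩)

lemma exists_single_add_iff (hS : IsSatBorelSet S) {m w : Fin (n + 1) →₀ ℕ} {i : Fin (n + 1)}
    (hw : ∀ a, w a ≠ 0 → i ≤ a) :
    (∃ v, m + w + Finsupp.single i v ∈ S) ↔ ∃ v, m + Finsupp.single i v ∈ S := by
  constructor
  · rintro ⟨v, hv⟩
    rw [add_right_comm] at hv
    have := hS.collect i w hw _ hv
    rw [add_assoc, ← Finsupp.single_add] at this
    exact ⟨_, this⟩
  · rintro ⟨v, hv⟩
    refine ⟨v, ?_⟩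
    rw [add_right_comm]
    exact hS.add_mem _ hv w

lemma lt_cod_add_iff (hS : IsSatBorelSet S) {m w : Fin (n + 1) →₀ ℕ} {c : ℕ}
    (hw : ∀ a, w a ≠ 0 → c ≤ (a : ℕ)) {i : ℕ} (hi : i ≤ c) :
    i < cod S (m + w) ↔ i < cod S m := by
  by_cases hin : i < n + 1
  · rw [show i = ((⟨i, hin⟩ : Fin (n + 1)) : ℕ) from rfl, hS.lt_cod_iff, hS.lt_cod_iff]
    exact hS.exists_single_add_iff fun a ha => by
      rw [Fin.le_def]
      exact hi.trans (hw a ha)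
  · have h1 := cod_le_succ (S := S) (m + w)
    have h2 := cod_le_succ (S := S) m
    omega

lemma cod_add_eq_iff (hS : IsSatBorelSet S) {m w : Fin (n + 1) →₀ ℕ} {c : ℕ}
    (hw : ∀ a, w a ≠ 0 → c ≤ (a : ℕ)) : cod S (m + w) = c ↔ cod S m = c := by
  have h1 := hS.lt_cod_add_iff (m := m) hw le_rfl
  rcases Nat.eq_zero_or_pos c with rfl | hc
  · omega
  · have h2 := hS.lt_cod_add_iff (m := m) hw (Nat.sub_le c 1)
    omega

lemma cod_filter (hS : IsSatBorelSet S) (u : Fin (n + 1) →₀ ℕ) :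
    cod S (u.filter fun a : Fin (n + 1) => (a : ℕ) < cod S u) = cod S u := by
  refine (hS.cod_add_eq_iff (w := u.filter fun a : Fin (n + 1) => ¬ (a : ℕ) < cod S u)
    (fun a => le_of_filter_not_lt_ne_zero)).1 ?_
  rw [Finsupp.filter_add_filter_not]

lemma filter_mem_apices (hS : IsSatBorelSet S) {u : Fin (n + 1) →₀ ℕ} (hu : u ∉ S) :
    (u.filter fun a : Fin (n + 1) => (a : ℕ) < cod S u) ∈ apices S := by
  constructor
  · rw [← hS.cod_le_iff, hS.cod_filter, hS.cod_le_iff]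
    exact hu
  · intro a ha
    rw [hS.cod_filter]
    by_contra h
    exact ha (filter_lt_apply_of_le _ h)

lemma cod_eq_of_agree (hS : IsSatBorelSet S) {m u : Fin (n + 1) →₀ ℕ} (hm : m ∈ apices S)
    (h : ∀ a : Fin (n + 1), (a : ℕ) < cod S m → u a = m a) : cod S u = cod S m := by
  have hfil : u.filter (fun a : Fin (n + 1) => (a : ℕ) < cod S m) = m := by
    ext a
    by_cases ha : (a : ℕ) < cod S m
    · rw [filter_lt_apply _ ha, h a ha]
    · rw [filter_lt_apply_of_le _ ha]
      by_contra hne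
      exact ha (hm.2 a (Ne.symm hne))
  rw [← Finsupp.filter_add_filter_not (p := fun a : Fin (n + 1) => (a : ℕ) < cod S m) (f := u), hfil]
  exact (hS.cod_add_eq_iff fun a => le_of_filter_not_lt_ne_zero).2 rfl

lemma notMem_of_agree (hS : IsSatBorelSet S) {m u : Fin (n + 1) →₀ ℕ} (hm : m ∈ apices S)
    (h : ∀ a : Fin (n + 1), (a : ℕ) < cod S m → u a = m a) : u ∉ S := by
  rw [← hS.cod_le_iff, hS.cod_eq_of_agree hm h, hS.cod_le_iff]
  exact hm.1

lemma exists_parent (hS : IsSatBorelSet S) {m : Fin (n + 1) →₀ ℕ} (hm : m ∈ apices S)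
    (h0 : m ≠ 0) : ∃ m' ∈ apices S, ∃ l : Fin (n + 1), m = m' + Finsupp.single l 1 ∧
      (l : ℕ) < cod S m' ∧ cod S m' ≤ cod S m := by
  have hne : m.support.Nonempty := Finsupp.support_nonempty_iff.2 h0
  set l := m.support.max' hne with hl
  have hlm : m l ≠ 0 := Finsupp.mem_support_iff.1 (m.support.max'_mem hne)
  have hmax : ∀ a, m a ≠ 0 → a ≤ l := fun a ha =>
    m.support.le_max' a (Finsupp.mem_support_iff.2 ha)
  have hle : Finsupp.single l 1 ≤ m := by
    rw [Finsupp.single_le_iff]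
    omega
  have hsplit : m = (m - Finsupp.single l 1) + Finsupp.single l 1 := (tsub_add_cancel_of_le hle).symm
  have hcod : (l : ℕ) < cod S (m - Finsupp.single l 1) := by
    obtain ⟨v, hv⟩ := (hS.lt_cod_iff m l).1 (hm.2 l hlm)
    rw [hsplit, add_assoc, ← Finsupp.single_add] at hv
    exact (hS.lt_cod_iff _ l).2 ⟨_, hv⟩
  have hle' : m - Finsupp.single l 1 ≤ m := tsub_le_self
  refine ⟨m - Finsupp.single l 1, ⟨fun h => hm.1 (hS.mem_of_le h hle'), fun a ha => ?_⟩, l, hsplit,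
    hcod, hS.cod_mono hle'⟩
  refine lt_of_le_of_lt ?_ hcod
  exact Fin.le_def.1 (hmax a fun h => ha (by simp [h]))

lemma exists_ancestor (hS : IsSatBorelSet S) (d : ℕ) : ∀ m ∈ apices S, m.degree = d → ∀ j ≤ d,
    ∃ m' ∈ apices S, m'.degree = j ∧ cod S m' ≤ cod S m := by
  induction d with
  | zero => exact fun m hm hd j hj => ⟨m, hm, by omega, le_rfl⟩
  | succ d ih =>
    intro m hm hd j hj
    rcases Nat.le_succ_iff.1 hj with hj | rfl
    · obtain ⟨m', hm', l, hl, -, hc⟩ := hS.exists_parent hm (by rintro rfl; simp at hd)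
      rw [hl, map_add, Finsupp.degree_single] at hd
      obtain ⟨m'', h1, h2, h3⟩ := ih m' hm' (by omega) j hj
      exact ⟨m'', h1, h2, h3.trans hc⟩
    · exact ⟨m, hm, hd, le_rfl⟩

lemma apices_degree_le (hS : IsSatBorelSet S) : ∃ D : ℕ, ∀ m ∈ apices S, m.degree ≤ D := by
  have hfin : {u | Minimal (· ∈ S) u}.Finite :=
    WellQuasiOrderedLE.finite_of_isAntichain (setOfPred_minimal_antichain _)
  obtain ⟨D, hD⟩ := (hfin.image Finsupp.degree).bddAbove
  refine ⟨D, fun m hm => ?_⟩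
  by_contra! hlt
  rcases Nat.eq_zero_or_pos (cod S m) with h0 | hpos
  · have : m = 0 := by
      ext a
      by_contra ha
      exact absurd (hm.2 a ha) (by omega)
    simp [this] at hlt
  · have hle := cod_le_succ (S := S) m
    set i : Fin (n + 1) := ⟨cod S m - 1, by omega⟩ with hi
    obtain ⟨v, hv⟩ := (hS.lt_cod_iff m i).1 (by simp only [hi]; omega)
    obtain ⟨g, hg, hgmin⟩ := exists_minimal_le_of_wellFoundedLT (· ∈ S) _ hv
    have hgD : g.degree ≤ D := hD ⟨g, hgmin, rfl⟩
    have hg' : g.erase i ≤ m := by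
      intro a
      by_cases ha : a = i
      · simp [ha]
      · rw [Finsupp.erase_ne ha]
        simpa [Finsupp.single_apply, Ne.symm ha] using hg a
    obtain ⟨w, hw⟩ := exists_add_of_le hg'
    have hsplit : g.erase i + Finsupp.single i (g i) = g := Finsupp.erase_add_single i g
    have hdeg1 := congrArg Finsupp.degree hw
    have hdeg2 := congrArg Finsupp.degree hsplit
    rw [map_add] at hdeg1 hdeg2
    rw [Finsupp.degree_single] at hdeg2
    apply hm.1
    rw [hw]
    refine hS.spread i w (fun a ha => ?_) _ (hS.mem_of_le hgmin.prop ?_)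
    · have := hm.2 a (by rw [hw]; simp [ha])
      rw [Fin.le_def]
      simp only [hi]
      omega
    · nth_rewrite 1 [← hsplit]
      exact add_le_add_right (Finsupp.single_mono (by omega)) _

lemma apices_finite (hS : IsSatBorelSet S) : (apices S).Finite := by
  obtain ⟨D, hD⟩ := hS.apices_degree_le
  refine ((Finset.range (D + 1)).biUnion fun t =>
    (Finset.univ : Finset (Fin (n + 1))).finsuppAntidiag t).finite_toSet.subset fun m hm => ?_
  rw [Finset.mem_coe, Finset.mem_biUnion]
  exact ⟨m.degree, Finset.mem_range.2 (Nat.lt_succ_of_le (hD m hm)), mem_finsuppAntidiag_univ.2 rfl⟩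

end IsSatBorelSet

open Classical in
lemma card_cone {n : ℕ} (m : Fin (n + 1) →₀ ℕ) {c t : ℕ} (hc : c ≤ n)
    (hm : ∀ a, m a ≠ 0 → (a : ℕ) < c) (ht : m.degree ≤ t) :
    (((Finset.univ : Finset (Fin (n + 1))).finsuppAntidiag t).filter
      fun u => ∀ a : Fin (n + 1), (a : ℕ) < c → u a = m a).card
      = (t - m.degree + (n - c)).choose (n - c) := by
  have hcard : (Finset.univ.filter fun a : Fin (n + 1) => c ≤ (a : ℕ)).card = n - c + 1 := by
    have : (Finset.univ.filter fun a : Fin (n + 1) => c ≤ (a : ℕ))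
        = Finset.Ici (⟨c, by omega⟩ : Fin (n + 1)) := by
      ext a
      simp [Fin.le_def]
    rw [this, Fin.card_Ici]
    simp only
    omega
  have key : ((Finset.univ.filter fun a : Fin (n + 1) => c ≤ (a : ℕ)).finsuppAntidiag
      (t - m.degree)).card = (t - m.degree + (n - c)).choose (n - c) := by
    rw [Finset.card_finsuppAntidiag_nat_eq_choose, hcard,
      show n - c + 1 + (t - m.degree) - 1 = t - m.degree + (n - c) by omega]
    exact (Nat.choose_symm_of_eq_add rfl)
  rw [← key]
  symm
  refine Finset.card_bij (fun w _ => m + w) ?_ ?_ ?_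
  · intro w hw
    rw [Finset.mem_finsuppAntidiag] at hw
    have hdeg : w.degree = t - m.degree := by
      rw [← hw.1, Finsupp.degree_apply]
      refine Finset.sum_subset hw.2 fun a _ ha => ?_
      simpa using ha
    rw [Finset.mem_filter, mem_finsuppAntidiag_univ, map_add, hdeg]
    refine ⟨by omega, fun a ha => ?_⟩
    have : w a = 0 := by
      by_contra hne
      have := hw.2 (Finsupp.mem_support_iff.2 hne)
      rw [Finset.mem_filter] at this
      omega
    simp [this]
  · exact fun w _ w' _ h => add_left_cancel h
  · intro u hu
    rw [Finset.mem_filter, mem_finsuppAntidiag_univ] at hu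
    have hle : m ≤ u := by
      intro a
      by_cases ha : (a : ℕ) < c
      · exact (hu.2 a ha).ge
      · have : m a = 0 := by
          by_contra hne
          exact ha (hm a hne)
        simp [this]
    obtain ⟨w, rfl⟩ := exists_add_of_le hle
    refine ⟨w, ?_, rfl⟩
    have hsub : w.support ⊆ Finset.univ.filter fun a : Fin (n + 1) => c ≤ (a : ℕ) := by
      intro a ha
      rw [Finset.mem_filter]
      refine ⟨Finset.mem_univ _, ?_⟩
      by_contra hlt
      have := hu.2 a (by omega)
      rw [Finsupp.add_apply] at this
      exact Finsupp.mem_support_iff.1 ha (by omega)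
    rw [Finset.mem_finsuppAntidiag]
    refine ⟨?_, hsub⟩
    have hdeg : w.degree = t - m.degree := by
      rw [← hu.1, map_add]
      omega
    rw [← hdeg, Finsupp.degree_apply]
    refine (Finset.sum_subset hsub fun a _ ha => ?_).symm
    simpa using ha

lemma IsSatBorelSet.complCount_eq {n : ℕ} {S : Set (Fin (n + 1) →₀ ℕ)} (hS : IsSatBorelSet S)
    {t : ℕ} (ht : ∀ m ∈ apices S, m.degree ≤ t) :
    complCount S t = ∑ m ∈ hS.apices_finite.toFinset,
      (t - m.degree + (n - cod S m)).choose (n - cod S m) := by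
  classical
  rw [complCount, Finset.card_eq_sum_card_fiberwise (t := hS.apices_finite.toFinset)
    (f := fun u => u.filter fun a : Fin (n + 1) => (a : ℕ) < cod S u)]
  · refine Finset.sum_congr rfl fun m hm => ?_
    rw [Set.Finite.mem_toFinset] at hm
    rw [← card_cone m (hS.cod_le_iff.2 hm.1) hm.2 (ht m hm)]
    congr 1
    ext u
    simp only [Finset.mem_filter, and_assoc]
    refine and_congr_right fun _ => ?_
    constructor
    · rintro ⟨hu, rfl⟩ a ha
      rw [hS.cod_filter] at ha
      rw [filter_lt_apply _ ha]
    · intro h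
      refine ⟨hS.notMem_of_agree hm h, ?_⟩
      rw [hS.cod_eq_of_agree hm h]
      ext a
      by_cases ha : (a : ℕ) < cod S m
      · rw [filter_lt_apply _ ha, h a ha]
      · rw [filter_lt_apply_of_le _ ha]
        by_contra hne
        exact ha (hm.2 a (Ne.symm hne))
  · intro u hu
    rw [Finset.mem_coe, Finset.mem_filter] at hu
    rw [Finset.mem_coe, Set.Finite.mem_toFinset]
    exact hS.filter_mem_apices hu.2

open Finset in
/-- The sorted list of degrees of the elements of `P` of dimension `i`. -/
def degList {α : Type*} (P : Finset α) (dim deg : α → ℕ) (i : ℕ) : List ℕ :=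
  ((P.filter fun m => dim m = i).val.map deg).sort (· ≤ ·)

section DegList

variable {α : Type*} {P : Finset α} {dim deg : α → ℕ}

lemma mem_degList {i x : ℕ} : x ∈ degList P dim deg i ↔ ∃ m ∈ P, dim m = i ∧ deg m = x := by
  simp [degList, Multiset.mem_sort, and_assoc]

lemma coe_degList (i : ℕ) : (degList P dim deg i : Multiset ℕ) =
    (P.filter fun m => dim m = i).val.map deg := Multiset.sort_eq _ _

lemma length_degList (i : ℕ) :
    (degList P dim deg i).length = (P.filter fun m => dim m = i).card := by
  rw [← Multiset.coe_card, coe_degList, Multiset.card_map, Finset.card_val]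

lemma sum_degList_length {i D : ℕ} (hD : ∀ m ∈ P, dim m ≤ D) :
    ∑ i' ∈ Finset.Ioc i D, (degList P dim deg i').length = (P.filter fun m => i < dim m).card := by
  rw [Finset.card_eq_sum_card_fiberwise (f := dim) (t := Finset.Ioc i D)]
  · refine Finset.sum_congr rfl fun i' hi' => ?_
    rw [length_degList, Finset.filter_filter]
    congr 1
    refine Finset.filter_congr fun m _ => ?_
    rw [Finset.mem_Ioc] at hi'
    constructor
    · rintro rfl
      exact ⟨hi'.1, rfl⟩
    · exact fun h => h.2
  · intro m hm
    simp only [Finset.coe_filter, Set.mem_ofPred_eq] at hm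
    simp [hm.2, hD m hm.1]

lemma sum_map_degList (D : ℕ) (hD : ∀ m ∈ P, dim m ≤ D) (g : ℕ → ℕ → Polynomial ℚ) :
    ∑ i ∈ Finset.range (D + 1), ((degList P dim deg i).map (g i)).sum =
      ∑ m ∈ P, g (dim m) (deg m) := by
  rw [← Finset.sum_fiberwise_of_maps_to (g := dim) (t := Finset.range (D + 1))]
  · refine Finset.sum_congr rfl fun i _ => ?_
    rw [← Multiset.sum_coe, ← Multiset.map_coe, coe_degList, Multiset.map_map]
    change ∑ m ∈ P with dim m = i, g i (deg m) = _
    refine Finset.sum_congr rfl fun m hm => ?_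
    rw [(Finset.mem_filter.1 hm).2]
  · exact fun m hm => Finset.mem_range.2 (Nat.lt_succ_of_le (hD m hm))

lemma countP_degList (i v : ℕ) : (degList P dim deg i).countP (· < v) =
    (P.filter fun m => dim m = i ∧ deg m < v).card := by
  rw [← Multiset.coe_countP, coe_degList, Multiset.countP_map, ← Finset.filter_filter]
  rfl

lemma countP_lt_getElem_le {L : List ℕ} (hL : L.Pairwise (· ≤ ·)) {k : ℕ} (hk : k < L.length) :
    L.countP (· < L[k]) ≤ k := by
  have h1 := List.countP_append (p := (· < L[k])) (l₁ := L.take k) (l₂ := L.drop k)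
  rw [List.take_append_drop] at h1
  have h2 : (L.drop k).countP (· < L[k]) = 0 := by
    rw [List.countP_eq_zero]
    intro x hx
    obtain ⟨i, hi, rfl⟩ := List.mem_iff_getElem.1 hx
    rw [List.getElem_drop]
    rw [List.pairwise_iff_getElem] at hL
    rcases Nat.eq_zero_or_pos i with rfl | hi0
    · simp
    · simpa using hL k (k + i) hk (by simp at hi; omega) (by omega)
  rw [h1, h2, add_zero]
  exact List.countP_le_length.trans (by simp)

lemma countP_lt_getElem {L : List ℕ} (hL : L.Pairwise (· < ·)) {k : ℕ} (hk : k < L.length) :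
    L.countP (· < L[k]) = k := by
  refine le_antisymm (countP_lt_getElem_le (hL.imp le_of_lt) hk) ?_
  have h1 := List.countP_append (p := (· < L[k])) (l₁ := L.take k) (l₂ := L.drop k)
  rw [List.take_append_drop] at h1
  have h2 : (L.take k).countP (· < L[k]) = (L.take k).length := by
    rw [List.countP_eq_length]
    intro x hx
    obtain ⟨i, hi, rfl⟩ := List.mem_iff_getElem.1 hx
    rw [List.getElem_take]
    rw [List.pairwise_iff_getElem] at hL
    simp at hi
    simpa using hL i k (by omega) hk (by omega)
  rw [h1, h2]
  simp
  omega

variable (hanc : ∀ m ∈ P, ∀ j ≤ deg m, ∃ m' ∈ P, deg m' = j ∧ dim m ≤ dim m')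

include hanc

lemma deg_le_card {m : α} (hm : m ∈ P) : deg m ≤ (P.filter fun x => dim m < dim x).card +
    (P.filter fun x => dim x = dim m ∧ deg x < deg m).card := by
  classical
  refine le_trans ?_ (Finset.card_union_le _ _)
  refine le_trans ?_ (Finset.card_image_le (f := deg))
  conv_lhs => rw [← Finset.card_range (deg m)]
  refine Finset.card_le_card fun j hj => ?_
  rw [Finset.mem_range] at hj
  obtain ⟨m', hm', rfl, hd⟩ := hanc m hm j hj.le
  simp only [Finset.mem_image, Finset.mem_union, Finset.mem_filter]
  refine ⟨m', ?_, rfl⟩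
  rcases hd.eq_or_lt with h | h
  · exact Or.inr ⟨hm', h.symm, hj⟩
  · exact Or.inl ⟨hm', h⟩

lemma deg_eq_card (hinj : Set.InjOn deg P) {m : α} (hm : m ∈ P) :
    deg m = (P.filter fun x => dim m < dim x).card +
    (P.filter fun x => dim x = dim m ∧ deg x < deg m).card := by
  classical
  refine le_antisymm (deg_le_card hanc hm) ?_
  rw [← Finset.card_union_of_disjoint]
  · rw [← Finset.card_image_of_injOn (f := deg)]
    · conv_rhs => rw [← Finset.card_range (deg m)]
      refine Finset.card_le_card fun j hj => ?_
      simp only [Finset.mem_image, Finset.mem_union, Finset.mem_filter] at hj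
      obtain ⟨x, hx, rfl⟩ := hj
      rw [Finset.mem_range]
      rcases hx with ⟨hx, h⟩ | ⟨_, _, h⟩
      · by_contra! hle
        obtain ⟨y, hy, h1, h2⟩ := hanc x hx _ hle
        have := hinj hy hm h1
        subst this
        omega
      · exact h
    · refine hinj.mono fun x hx => ?_
      simp only [Finset.coe_union, Finset.coe_filter, Set.mem_union, Set.mem_ofPred_eq] at hx
      tauto
  · rw [Finset.disjoint_left]
    intro x hx hx'
    rw [Finset.mem_filter] at hx hx'
    omega

variable {D : ℕ} (hD : ∀ m ∈ P, dim m ≤ D)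

include hD

lemma slowFrom_degList (i : ℕ) :
    SlowFrom (∑ i' ∈ Finset.Ioc i D, (degList P dim deg i').length) (degList P dim deg i) := by
  intro k hk
  rw [sum_degList_length hD]
  obtain ⟨m, hm, rfl, hx⟩ := mem_degList.1 (List.getElem_mem hk)
  refine hx ▸ (deg_le_card hanc hm).trans ?_
  gcongr
  rw [← countP_degList, hx]
  exact countP_lt_getElem_le (Multiset.pairwise_sort _ _) hk

lemma degList_eq_range' (hinj : Set.InjOn deg P) (i : ℕ) :
    degList P dim deg i = List.range' (∑ i' ∈ Finset.Ioc i D, (degList P dim deg i').length)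
      (degList P dim deg i).length := by
  refine List.ext_getElem (by simp) fun k hk _ => ?_
  rw [List.getElem_range', one_mul, sum_degList_length hD]
  obtain ⟨m, hm, rfl, hx⟩ := mem_degList.1 (List.getElem_mem hk)
  refine hx ▸ (deg_eq_card hanc hinj hm).trans ?_
  congr 1
  rw [← countP_degList, hx]
  refine countP_lt_getElem ?_ hk
  have h1 : (degList P dim deg (dim m)).Nodup := by
    rw [← Multiset.coe_nodup, coe_degList]
    exact Finset.nodup_map_iff_injOn.2 (hinj.mono (Finset.coe_subset.2 (Finset.filter_subset _ _)))
  have h2 := Multiset.pairwise_sort ((P.filter fun x => dim x = dim m).val.map deg) (· ≤ ·)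
  exact (h2.and h1).imp fun h => lt_of_le_of_ne h.1 h.2

variable {B : ℕ → ℕ} {r : ℕ} (hB : Antitone B) (hBD : B 0 ≤ D)
  (hsum : ∑ m ∈ P, gotzmannTerm (dim m) (deg m) = ∑ j ∈ Finset.range r, gotzmannTerm (B j) j)

include hB hBD hsum

omit hanc in
lemma card_filter_dim_eq : (P.filter fun m => dim m = D).card = countGE B r D := by
  rw [← length_degList (deg := deg), length_eq_of_gotzmann_sum_eq (E := countGE B r) (D := D),
    countGE_eq_zero hB (Nat.lt_succ_of_le hBD), Nat.sub_zero]
  rw [sum_map_degList D hD gotzmannTerm, hsum, gotzmann_sum_eq_block_sum hB hBD]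

lemma card_le_and_degList_eq : P.card ≤ r ∧ ((countGE B r 1 = r ∨ Set.InjOn deg P) →
    ∀ i ≤ D, degList P dim deg i =
      List.range' (countGE B r (i + 1)) (countGE B r i - countGE B r (i + 1))) := by
  have h := slow_sum_comparison (countGE B r) (countGE_antitone B r) D (degList P dim deg)
  rw [countGE_eq_zero hB (Nat.lt_succ_of_le hBD), sum_map_degList D hD gotzmannTerm, hsum,
    gotzmann_sum_eq_block_sum hB hBD, countGE_zero] at h
  simp only [zero_add] at h
  obtain ⟨h1, h2⟩ := h (fun i _ => slowFrom_degList hanc hD i) trivial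
  constructor
  · rw [Finset.card_eq_sum_card_fiberwise (f := dim) (t := Finset.range (D + 1))]
    · simpa only [length_degList] using h1
    · intro m hm
      have := hD m hm
      simp
      omega
  · rintro (h | h)
    · exact h2 (Or.inl h.symm)
    · exact h2 (Or.inr fun i _ => degList_eq_range' hanc hD h i)

/-- If the Gotzmann-type sums of `P` and `B` agree, then under either hypothesis `deg` identifies
`P` with `{0, …, r - 1}` and `dim` with `B`. -/
lemma gotzmann_rigidity (h : countGE B r 1 = r ∨ Set.InjOn deg P) :
    (∀ m ∈ P, deg m < r ∧ B (deg m) = dim m) ∧ (∀ j < r, ∃ m ∈ P, deg m = j) ∧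
      Set.InjOn deg P := by
  have key := (card_le_and_degList_eq hanc hD hB hBD hsum).2 h
  have h1 : ∀ m ∈ P, deg m < r ∧ B (deg m) = dim m := by
    intro m hm
    have hmem : deg m ∈ degList P dim deg (dim m) := mem_degList.2 ⟨m, hm, rfl, rfl⟩
    rw [key _ (hD m hm), List.mem_range'_1] at hmem
    have h3 := (lt_countGE_iff hB (r := r) (i := dim m) (j := deg m)).1 (by omega)
    have h4 := (lt_countGE_iff hB (r := r) (i := dim m + 1) (j := deg m)).not.1 (by omega)
    omega
  refine ⟨h1, fun j hj => ?_, fun x hx y hy hxy => ?_⟩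
  · have hmem : j ∈ degList P dim deg (B j) := by
      rw [key _ ((hB (Nat.zero_le j)).trans hBD), List.mem_range'_1]
      have h3 := (lt_countGE_iff hB (r := r) (i := B j) (j := j)).2 ⟨hj, le_rfl⟩
      have h4 := (lt_countGE_iff hB (r := r) (i := B j + 1) (j := j)).not.2 (by omega)
      omega
    obtain ⟨m, hm, _, hd⟩ := mem_degList.1 hmem
    exact ⟨m, hm, hd⟩
  · have hd : dim x = dim y := by rw [← (h1 x hx).2, ← (h1 y hy).2, hxy]
    have hnd : (degList P dim deg (dim x)).Nodup := by
      rw [key _ (hD x hx)]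
      exact List.nodup_range'
    rw [← Multiset.coe_nodup, coe_degList] at hnd
    exact Finset.nodup_map_iff_injOn.1 hnd (by simpa using hx) (by simp [hd, Finset.mem_coe.1 hy])
      hxy

end DegList

lemma injOn_deg_of_card_le {α : Type*} {P : Finset α} {deg : α → ℕ} {σ : ℕ}
    (hanc : ∀ m ∈ P, ∀ j ≤ deg m, ∃ m' ∈ P, deg m' = j) (hcard : P.card ≤ σ + 2)
    (huniq : ∀ x ∈ P, ∀ y ∈ P, deg x = deg y → deg x ≤ σ → x = y) : Set.InjOn deg P := by
  classical
  intro x hx y hy hxy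
  by_contra hne
  have hσ : σ < deg x := by
    by_contra! h
    exact hne (huniq x hx y hy hxy h)
  have hsub : Finset.range (σ + 1) ⊆ ((P.erase x).erase y).image deg := by
    intro j hj
    rw [Finset.mem_range] at hj
    obtain ⟨m, hm, rfl⟩ := hanc x hx j (by omega)
    refine Finset.mem_image_of_mem _ (Finset.mem_erase.2 ⟨?_, Finset.mem_erase.2 ⟨?_, hm⟩⟩)
    · rintro rfl
      omega
    · rintro rfl
      omega
  have h1 := (Finset.card_le_card hsub).trans Finset.card_image_le
  rw [Finset.card_range, Finset.card_erase_of_mem (Finset.mem_erase.2 ⟨Ne.symm hne, hy⟩),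
    Finset.card_erase_of_mem hx] at h1
  have h2 : 1 ≤ P.card := Finset.card_pos.2 ⟨x, hx⟩
  omega

/-- The exponent of `x_a` in the apex of degree `j` of the Stanley decomposition of the quotient by
the lexicographic ideal. -/
def coneApex (n : ℕ) (B : ℕ → ℕ) (j a : ℕ) : ℕ :=
  ((Finset.range j).filter fun j' => B j' + a + 1 = n).card

/-- Membership of `u` in the `j`-th cone of the Stanley decomposition of the quotient by the
lexicographic ideal. -/
def InCone {n : ℕ} (B : ℕ → ℕ) (j : ℕ) (u : Fin (n + 1) →₀ ℕ) : Prop :=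
  ∀ a : Fin (n + 1), (a : ℕ) + B j < n → u a = coneApex n B j a

lemma coneApex_zero (n : ℕ) (B : ℕ → ℕ) (a : ℕ) : coneApex n B 0 a = 0 := rfl

lemma coneApex_succ (n : ℕ) (B : ℕ → ℕ) (j a : ℕ) :
    coneApex n B (j + 1) a = coneApex n B j a + if B j + a + 1 = n then 1 else 0 := by
  rw [coneApex, coneApex, Finset.range_add_one, Finset.filter_insert]
  split_ifs with h
  · rw [Finset.card_insert_of_notMem (by simp)]
  · rw [add_zero]

namespace IsSatBorelSet

variable {n : ℕ} {S : Set (Fin (n + 1) →₀ ℕ)}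

lemma eq_add_single_of_injOn (hS : IsSatBorelSet S)
    (hinj : Set.InjOn (fun m : Fin (n + 1) →₀ ℕ => m.degree) (apices S))
    {m : Fin (n + 1) →₀ ℕ} (hm : m ∈ apices S) (h0 : m ≠ 0) :
    ∃ m' ∈ apices S, ∃ l : Fin (n + 1), m = m' + Finsupp.single l 1 ∧ (l : ℕ) + 1 = cod S m' := by
  obtain ⟨m', hm', l, rfl, hl, -⟩ := hS.exists_parent hm h0
  refine ⟨m', hm', l, rfl, ?_⟩
  by_contra hne
  have hle := cod_le_succ (S := S) m'
  set q : Fin (n + 1) := ⟨cod S m' - 1, by omega⟩ with hq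
  have hlq : l < q := by
    rw [Fin.lt_def]
    simp only [hq]
    omega
  have hmem : m' + Finsupp.single q 1 ∈ apices S := by
    refine ⟨fun h => hm.1 (hS.borel _ _ _ hlq h), fun a ha => ?_⟩
    refine lt_of_lt_of_le ?_ (hS.cod_mono (le_self_add : m' ≤ m' + Finsupp.single q 1))
    rcases eq_or_ne a q with rfl | haq
    · simp only [hq]
      omega
    · exact hm'.2 a (by simpa [Finsupp.single_apply, haq.symm] using ha)
  have heq := hinj hmem hm (by simp)
  have := DFunLike.congr_fun (add_left_cancel heq) q
  simp [hlq.ne] at this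

variable {B : ℕ → ℕ} {r : ℕ}

lemma gotzmann_sum_apices (hS : IsSatBorelSet S) {p : Polynomial ℚ}
    (hcount : ∃ N : ℕ, ∀ t, N ≤ t → (complCount S t : ℚ) = p.eval (t : ℚ)) :
    ∑ m ∈ hS.apices_finite.toFinset, gotzmannTerm (n - cod S m) m.degree = p := by
  obtain ⟨N, hN⟩ := hcount
  obtain ⟨D, hD⟩ := hS.apices_degree_le
  refine polynomial_eq_of_eventually_eval (max N D) fun t ht => ?_
  have hD' : ∀ m ∈ apices S, m.degree ≤ t := fun m hm => (hD m hm).trans (by omega)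
  rw [← hN t (by omega), hS.complCount_eq hD', Polynomial.eval_finsetSum, Nat.cast_sum]
  refine Finset.sum_congr rfl fun m hm => ?_
  exact gotzmannTerm_eval (hD' m (hS.apices_finite.mem_toFinset.1 hm))

lemma exists_ancestor_finset (hS : IsSatBorelSet S) : ∀ m ∈ hS.apices_finite.toFinset,
    ∀ j ≤ m.degree, ∃ m' ∈ hS.apices_finite.toFinset, m'.degree = j ∧
      n - cod S m ≤ n - cod S m' := by
  intro m hm j hj
  obtain ⟨m', h1, h2, h3⟩ := hS.exists_ancestor _ m (hS.apices_finite.mem_toFinset.1 hm) rfl j hj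
  exact ⟨m', hS.apices_finite.mem_toFinset.2 h1, h2, by omega⟩

/-- In codimension one, the apices of small degree are powers of `x_0`. -/
lemma apex_eq_single (hS : IsSatBorelSet S) (hB : Antitone B) (hn : B 0 + 1 = n)
    (hsum : ∑ m ∈ hS.apices_finite.toFinset, gotzmannTerm (n - cod S m) m.degree =
      ∑ j ∈ Finset.range r, gotzmannTerm (B j) j) {m : Fin (n + 1) →₀ ℕ} (hm : m ∈ apices S)
    (hdeg : m.degree ≤ countGE B r (B 0)) : m = Finsupp.single 0 m.degree := by
  classical
  set P := hS.apices_finite.toFinset with hP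
  have hmemP : ∀ {x}, x ∈ P ↔ x ∈ apices S := hS.apices_finite.mem_toFinset
  have hcodle : ∀ x ∈ apices S, cod S x ≤ n := fun x hx => hS.cod_le_iff.2 hx.1
  have hn0 := card_filter_dim_eq (P := P) (dim := fun m => n - cod S m) (deg := Finsupp.degree)
    (D := n) (by simp) hB (by omega) hsum
  rw [countGE_eq_zero hB (by omega), Finset.card_eq_zero, Finset.filter_eq_empty_iff] at hn0
  have hcod1 : ∀ x ∈ apices S, 1 ≤ cod S x := by
    intro x hx
    have := hn0 (hmemP.2 hx)
    have := hcodle x hx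
    omega
  have hn1 := card_filter_dim_eq (P := P) (dim := fun m => n - cod S m) (deg := Finsupp.degree)
    (D := B 0) (fun x hx => by have := hcod1 x (hmemP.1 hx); omega) hB le_rfl hsum
  have hone : ∀ x ∈ apices S, cod S x = 1 → x = Finsupp.single 0 x.degree := by
    intro x hx h1
    have hx' : x = Finsupp.single 0 (x 0) := by
      ext a
      rcases eq_or_ne a 0 with rfl | ha
      · simp
      · rw [Finsupp.single_apply, if_neg ha.symm]
        by_contra hne
        have := hx.2 a hne
        rw [h1] at this
        exact ha (Fin.ext (by simpa using this))
    rw [hx', Finsupp.degree_single]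
  have hex : ∀ j < countGE B r (B 0), Finsupp.single 0 j ∈ apices S ∧
      cod S (Finsupp.single (0 : Fin (n + 1)) j) = 1 := by
    intro j hj
    by_contra hnot
    rw [← hn1] at hj
    refine absurd hj (not_lt.2 ?_)
    rw [← Finset.card_image_of_injOn (f := Finsupp.degree)]
    · conv_rhs => rw [← Finset.card_range j]
      refine Finset.card_le_card fun v hv => ?_
      obtain ⟨x, hx, rfl⟩ := Finset.mem_image.1 hv
      rw [Finset.mem_filter, hmemP] at hx
      rw [Finset.mem_range]
      by_contra! hjx
      obtain ⟨y, hy, rfl, hyc⟩ := hS.exists_ancestor _ x hx.1 rfl j hjx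
      have h1 := hcod1 y hy
      have h2 := hcodle y hy
      have h3 : cod S y = 1 := by omega
      rw [← hone y hy h3] at hnot
      exact hnot ⟨hy, h3⟩
    · intro x hx y hy hxy
      simp only [Finset.coe_filter, Set.mem_ofPred_eq, hmemP] at hx hy
      have hxc := hcodle x hx.1
      have hyc := hcodle y hy.1
      rw [hone x hx.1 (by omega), hone y hy.1 (by omega), hxy]
  have hm0 : m 0 ≤ m.degree := Finsupp.le_degree 0 m
  rcases lt_or_ge (m 0) (countGE B r (B 0)) with h | h
  · obtain ⟨h1, h2⟩ := hex _ h
    refine hone m hm ?_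
    rw [hS.cod_eq_of_agree h1, h2]
    intro a ha
    rw [h2] at ha
    rw [show a = 0 from Fin.ext (by simpa using ha)]
    simp
  · have h1 : m.degree = m 0 := by omega
    have hle : Finsupp.single 0 m.degree ≤ m := by
      rw [Finsupp.single_le_iff]
      omega
    obtain ⟨w, hw⟩ := exists_add_of_le hle
    have h2 := congrArg Finsupp.degree hw
    rw [map_add, Finsupp.degree_single] at h2
    have h3 : w = 0 := by
      rw [← Finsupp.degree_eq_zero_iff]
      omega
    rwa [h3, add_zero] at hw

/-- Under either of the two hypotheses, a saturated Borel set with the Hilbert polynomial given by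
`B` is the complement of the cones determined by `B`. -/
lemma notMem_iff_inCone (hS : IsSatBorelSet S) (hB : Antitone B) (hn : B 0 < n)
    (hcount : ∃ N : ℕ, ∀ t, N ≤ t → (complCount S t : ℚ) =
      (∑ j ∈ Finset.range r, gotzmannTerm (B j) j).eval (t : ℚ))
    (hcond : countGE B r 1 = r ∨ r ≤ 2 ∨ (B 0 + 1 = n ∧ r ≤ countGE B r (B 0) + 2))
    (u : Fin (n + 1) →₀ ℕ) : u ∉ S ↔ ∃ j < r, InCone B j u := by
  have hsum := hS.gotzmann_sum_apices hcount
  have hmemP : ∀ {x}, x ∈ hS.apices_finite.toFinset ↔ x ∈ apices S := hS.apices_finite.mem_toFinset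
  have hanc := hS.exists_ancestor_finset
  have hcard := (card_le_and_degList_eq (dim := fun m => n - cod S m) (deg := Finsupp.degree)
    (D := n) hanc (by simp) hB hn.le hsum).1
  have hanc' : ∀ m ∈ hS.apices_finite.toFinset, ∀ j ≤ m.degree,
      ∃ m' ∈ hS.apices_finite.toFinset, m'.degree = j := fun m hm j hj => by
    obtain ⟨m', h1, h2, -⟩ := hanc m hm j hj
    exact ⟨m', h1, h2⟩
  obtain ⟨hlt, hex, hinj⟩ := gotzmann_rigidity (dim := fun m => n - cod S m)
    (deg := Finsupp.degree) (D := n) hanc (by simp) hB hn.le hsum (by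
      rcases hcond with h | h | ⟨h, h'⟩
      · exact Or.inl h
      · refine Or.inr (injOn_deg_of_card_le (σ := 0) hanc' (by omega) fun x _ y _ hxy hx => ?_)
        rw [Nat.le_zero] at hx
        rw [(Finsupp.degree_eq_zero_iff x).1 hx, (Finsupp.degree_eq_zero_iff y).1 (hxy ▸ hx)]
      · refine Or.inr (injOn_deg_of_card_le hanc' (hcard.trans h') fun x hx y hy hxy hxs => ?_)
        rw [hS.apex_eq_single hB h hsum (hmemP.1 hx) hxs,
          hS.apex_eq_single hB h hsum (hmemP.1 hy) (hxy ▸ hxs), hxy])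
  rw [Set.Finite.coe_toFinset] at hinj
  have hcod : ∀ m ∈ apices S, cod S m + B m.degree = n ∧ m.degree < r := by
    intro m hm
    have h1 := hlt m (hmemP.2 hm)
    have h2 := hS.cod_le_iff.2 hm.1
    omega
  have hapex : ∀ j, ∀ m ∈ apices S, m.degree = j → ∀ a, m a = coneApex n B j a := by
    intro j
    induction j with
    | zero =>
      intro m hm h0 a
      rw [(Finsupp.degree_eq_zero_iff m).1 h0, coneApex_zero]
      rfl
    | succ j ih =>
      intro m hm hj a
      obtain ⟨m', hm', l, rfl, hl⟩ := hS.eq_add_single_of_injOn hinj hm (by rintro rfl; simp at hj)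
      rw [map_add, Finsupp.degree_single] at hj
      have hj' : m'.degree = j := by omega
      have h1 := (hcod m' hm').1
      rw [hj'] at h1
      rw [Finsupp.add_apply, ih m' hm' hj' a, coneApex_succ, Finsupp.single_apply]
      congr 1
      refine if_congr ?_ rfl rfl
      rw [Fin.ext_iff]
      omega
  constructor
  · intro hu
    have hm := hS.filter_mem_apices hu
    obtain ⟨h1, h2⟩ := hcod _ hm
    rw [hS.cod_filter] at h1
    refine ⟨_, h2, fun a ha => ?_⟩
    rw [← hapex _ _ hm rfl, filter_lt_apply _ (by omega)]
  · rintro ⟨j, hj, hu⟩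
    obtain ⟨m, hm, hmj⟩ := hex j hj
    rw [hmemP] at hm
    refine hS.notMem_of_agree hm fun a ha => ?_
    have h1 := (hcod m hm).1
    rw [hmj] at h1
    rw [hapex j m hm hmj, hu a (by omega)]

end IsSatBorelSet

/-- Restricted to the variables `x_0, …, x_{n-1}`, the exponent `u` first differs from `α` at an
index where it is smaller. -/
def LexBelow {n : ℕ} (α : ℕ → ℕ) (u : Fin (n + 1) →₀ ℕ) : Prop :=
  ∃ τ : Fin (n + 1), (τ : ℕ) < n ∧ (∀ a < τ, u a = α a) ∧ u τ < α τ

lemma lexBelow_of_le {n : ℕ} {α : ℕ → ℕ} {u : Fin (n + 1) →₀ ℕ} {τ : Fin (n + 1)} (hτ : (τ : ℕ) < n)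
    (h : ∀ a < τ, u a ≤ α a) (hlt : u τ < α τ) : LexBelow α u := by
  by_cases hex : ∃ a < τ, u a ≠ α a
  · have hfin : {a | a < τ ∧ u a ≠ α a}.Finite := Set.toFinite _
    obtain ⟨a, ⟨haτ, hne⟩, hmin⟩ := hfin.exists_minimal hex
    refine ⟨a, lt_trans (Fin.lt_def.1 haτ) hτ, fun b hb => ?_, lt_of_le_of_ne (h a haτ) hne⟩
    by_contra hb'
    exact absurd (hmin ⟨hb.trans haτ, hb'⟩ hb.le) (not_le.2 hb)
  · push Not at hex
    exact ⟨τ, hτ, hex, hlt⟩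

lemma isSatBorelSet_lexBelow (n : ℕ) (α : ℕ → ℕ) :
    IsSatBorelSet {u : Fin (n + 1) →₀ ℕ | ¬ LexBelow α u} where
  add_mem := by
    rintro u hu w ⟨τ, hτ, h, hlt⟩
    exact hu (lexBelow_of_le hτ (fun a ha => (Nat.le_add_right _ _).trans (h a ha).le)
      ((Nat.le_add_right _ _).trans_lt hlt))
  borel := by
    rintro u i j hij hu ⟨τ, hτ, h, hlt⟩
    refine hu ?_
    have hle : ∀ a < j, (u + Finsupp.single j 1 : Fin (n + 1) →₀ ℕ) a ≤
        (u + Finsupp.single i 1 : Fin (n + 1) →₀ ℕ) a := by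
      intro a ha
      simp [Finsupp.single_apply, ha.ne']
    rcases lt_or_ge τ j with hτj | hτj
    · exact lexBelow_of_le hτ (fun a ha => (hle a (ha.trans hτj)).trans (h a ha).le)
        ((hle τ hτj).trans_lt hlt)
    · have hiτ := hij.trans_le hτj
      refine lexBelow_of_le (τ := i) (lt_trans (Fin.lt_def.1 hiτ) hτ)
        (fun a ha => (hle a (ha.trans hij)).trans (h a (ha.trans hiτ)).le) ?_
      rw [← h i hiτ]
      simp [hij.ne']
  sat := by
    rintro u hu ⟨τ, hτ, h, hlt⟩
    have hne : ∀ a : Fin (n + 1), (a : ℕ) < n →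
        (u + Finsupp.single (Fin.last n) 1 : Fin (n + 1) →₀ ℕ) a = u a := by
      intro a ha
      rw [Finsupp.add_apply, Finsupp.single_apply, if_neg, add_zero]
      rintro rfl
      simp at ha
    exact hu ⟨τ, hτ, fun a ha => by rw [hne a ((Fin.lt_def.1 ha).trans hτ), h a ha],
      by rwa [hne τ hτ]⟩

section Cones

variable {n r : ℕ} {B : ℕ → ℕ}

lemma coneApex_mono {j j' : ℕ} (h : j ≤ j') (a : ℕ) : coneApex n B j a ≤ coneApex n B j' a :=
  Finset.card_le_card (Finset.filter_subset_filter _ (Finset.range_subset_range.2 h))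

lemma coneApex_eq_of_le (hB : Antitone B) {j j' a : ℕ} (h : j ≤ j') (ha : B j + a + 1 < n) :
    coneApex n B j a = coneApex n B j' a := by
  rw [coneApex, coneApex]
  congr 1
  ext i
  simp only [Finset.mem_filter, Finset.mem_range]
  constructor
  · rintro ⟨h1, h2⟩
    exact ⟨by omega, h2⟩
  · rintro ⟨h1, h2⟩
    refine ⟨?_, h2⟩
    by_contra! hji
    have := hB hji
    omega

lemma coneApex_lt {j j' a : ℕ} (h : j < j') (ha : B j + a + 1 = n) :
    coneApex n B j a < coneApex n B j' a := by
  refine lt_of_lt_of_le ?_ (coneApex_mono (Nat.succ_le_of_lt h) a)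
  rw [coneApex_succ, if_pos ha]
  exact Nat.lt_succ_self _

lemma exists_inCone_iff (hB : Antitone B) (hn : B 0 < n) (u : Fin (n + 1) →₀ ℕ) :
    (∃ j < r, InCone B j u) ↔ LexBelow (coneApex n B r) u := by
  constructor
  · rintro ⟨j, hj, hu⟩
    have hj0 := hB (Nat.zero_le j)
    refine ⟨⟨n - 1 - B j, by omega⟩, by simp only; omega, fun a ha => ?_, ?_⟩
    · rw [Fin.lt_def] at ha
      simp only at ha
      rw [hu a (by omega), coneApex_eq_of_le hB hj.le (by omega)]
    · rw [hu _ (by simp only; omega)]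
      exact coneApex_lt hj (by simp only; omega)
  · rintro ⟨τ, hτ, h, hlt⟩
    have hex : ∃ j, u τ < coneApex n B (j + 1) τ := ⟨r, hlt.trans_le (coneApex_mono (by omega) _)⟩
    classical
    obtain ⟨j, hj, hmin⟩ := Nat.findX hex
    have hle : coneApex n B j τ ≤ u τ := by
      rcases j with _ | j
      · simp [coneApex_zero]
      · exact not_lt.1 (hmin j (Nat.lt_succ_self j))
    rw [coneApex_succ] at hj
    have hjr : j < r := by
      by_contra! hrj
      have := coneApex_mono (n := n) (B := B) hrj τ
      omega
    split_ifs at hj with hBj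
    · refine ⟨j, hjr, fun a ha => ?_⟩
      rcases (show a ≤ τ by rw [Fin.le_def]; omega).eq_or_lt with rfl | haτ
      · omega
      · rw [h a haτ]
        rw [Fin.lt_def] at haτ
        exact (coneApex_eq_of_le hB hjr.le (by omega)).symm
    · omega

lemma inCone_injective (hB : Antitone B) (hn : B 0 < n) {u : Fin (n + 1) →₀ ℕ} {j j' : ℕ}
    (h : InCone B j u) (h' : InCone B j' u) : j = j' := by
  wlog hlt : j < j' generalizing j j'
  · rcases (not_lt.1 hlt).eq_or_lt with h1 | h1
    · exact h1.symm
    · exact (this h' h h1).symm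
  have h0 := hB (Nat.zero_le j)
  have h1 := hB hlt.le
  have h2 := h ⟨n - 1 - B j, by omega⟩ (by simp only; omega)
  have h3 := h' ⟨n - 1 - B j, by omega⟩ (by simp only; omega)
  have h4 := coneApex_lt (n := n) (B := B) (a := n - 1 - B j) hlt (by omega)
  simp only at h2 h3
  omega

variable (n B) in
/-- The apex of the `j`-th cone of the quotient by the lexicographic ideal. -/
noncomputable def apexVec (j : ℕ) : Fin (n + 1) →₀ ℕ :=
  Finsupp.equivFunOnFinite.symm fun a => coneApex n B j a

lemma apexVec_apply (j : ℕ) (a : Fin (n + 1)) : apexVec n B j a = coneApex n B j a := rfl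

lemma add_lt_of_apexVec_ne_zero (hB : Antitone B) {j : ℕ} {a : Fin (n + 1)}
    (ha : apexVec n B j a ≠ 0) : (a : ℕ) + B j < n := by
  rw [apexVec_apply, coneApex, Finset.card_ne_zero] at ha
  obtain ⟨i, hi⟩ := ha
  rw [Finset.mem_filter, Finset.mem_range] at hi
  have := hB hi.1.le
  omega

lemma degree_apexVec (hB : Antitone B) (hn : B 0 < n) (j : ℕ) : (apexVec n B j).degree = j := by
  rw [Finsupp.degree_eq_sum]
  conv_rhs => rw [← Finset.card_range j]
  rw [Finset.card_eq_sum_card_fiberwise (t := Finset.univ)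
    (f := fun i => (⟨n - 1 - B i, by omega⟩ : Fin (n + 1))) (by simp)]
  refine Finset.sum_congr rfl fun a _ => ?_
  rw [apexVec_apply, coneApex]
  congr 1
  refine Finset.filter_congr fun i _ => ?_
  have := hB (Nat.zero_le i)
  rw [Fin.ext_iff]
  simp only
  omega

lemma complCount_eq_of_cones {S : Set (Fin (n + 1) →₀ ℕ)} {m : ℕ → Fin (n + 1) →₀ ℕ} {c : ℕ → ℕ}
    {q t : ℕ} (hc : ∀ j < q, c j ≤ n) (hm : ∀ j < q, ∀ a, m j a ≠ 0 → (a : ℕ) < c j)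
    (ht : ∀ j < q, (m j).degree ≤ t)
    (hdisj : ∀ i < q, ∀ j < q, ∀ u : Fin (n + 1) →₀ ℕ,
      (∀ a : Fin (n + 1), (a : ℕ) < c i → u a = m i a) →
      (∀ a : Fin (n + 1), (a : ℕ) < c j → u a = m j a) → i = j)
    (hS : ∀ u, u ∉ S ↔ ∃ j < q, ∀ a : Fin (n + 1), (a : ℕ) < c j → u a = m j a) :
    complCount S t = ∑ j ∈ Finset.range q, (t - (m j).degree + (n - c j)).choose (n - c j) := by
  classical
  have heq : (Finset.univ.finsuppAntidiag t).filter (· ∉ S) = (Finset.range q).biUnion fun j =>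
      (Finset.univ.finsuppAntidiag t).filter
        fun u => ∀ a : Fin (n + 1), (a : ℕ) < c j → u a = m j a := by
    ext u
    simp only [Finset.mem_filter, Finset.mem_biUnion, Finset.mem_range, hS]
    tauto
  rw [complCount]
  convert_to ((Finset.univ.finsuppAntidiag t).filter (· ∉ S)).card = _
  rw [heq, Finset.card_biUnion]
  · refine Finset.sum_congr rfl fun j hj => ?_
    rw [Finset.mem_range] at hj
    rw [← card_cone (m j) (hc j hj) (hm j hj) (ht j hj)]
  · intro i hi j hj hij
    rw [Function.onFun, Finset.disjoint_left]
    intro u hu hu'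
    rw [Finset.mem_filter] at hu hu'
    exact hij (hdisj i (Finset.mem_range.1 hi) j (Finset.mem_range.1 hj) u hu.2 hu'.2)

end Cones

section Modification

variable {n σ q : ℕ} {B : ℕ → ℕ}

/-- The exponent of `x_0^σ x_m`, where `m = n - 2 - B σ`. -/
noncomputable def altApex (n σ : ℕ) (B : ℕ → ℕ) : Fin (n + 1) →₀ ℕ :=
  Finsupp.single 0 σ + Finsupp.single (Fin.ofNat (n + 1) (n - 2 - B σ)) 1

variable (n σ q B) in
/-- The set obtained from the lexicographic one by replacing the last cone by the one at
`altApex`. -/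
def altSet : Set (Fin (n + 1) →₀ ℕ) :=
  {u | ¬ LexBelow (coneApex n B q) u ∧ ¬ ∀ a : Fin (n + 1), (a : ℕ) < n → u a = altApex n σ B a}

lemma altApex_apply (a : Fin (n + 1)) : altApex n σ B a =
    (if (a : ℕ) = 0 then σ else 0) + if (a : ℕ) = n - 2 - B σ then 1 else 0 := by
  rw [altApex, Finsupp.add_apply, Finsupp.single_apply, Finsupp.single_apply]
  congr 1
  · exact if_congr (by rw [Fin.ext_iff, eq_comm]; rfl) rfl rfl
  · refine if_congr ?_ rfl rfl
    rw [Fin.ext_iff, Fin.val_ofNat, Nat.mod_eq_of_lt (by omega), eq_comm]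

variable (hB : Antitone B) (h1 : ∀ j < σ, B j + 1 = n) (h2 : B σ + 2 ≤ n) (h3 : σ + 2 ≤ q)

include hB h1 h2 h3

omit h2 in
lemma coneApex_of_add_lt {a : ℕ} (ha : B σ + a + 1 < n) :
    coneApex n B q a = if a = 0 then σ else 0 := by
  rw [← coneApex_eq_of_le hB (show σ ≤ q by omega) ha, coneApex]
  split_ifs with h0
  · subst h0
    rw [Finset.filter_true_of_mem, Finset.card_range]
    intro j hj
    exact h1 j (Finset.mem_range.1 hj)
  · rw [Finset.card_eq_zero, Finset.filter_eq_empty_iff]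
    intro j hj
    have := h1 j (Finset.mem_range.1 hj)
    omega

omit h1 in
lemma lexBelow_of_sum_le_one {u : Fin (n + 1) →₀ ℕ}
    (hu : ∀ a : Fin (n + 1), B σ + a + 1 < n → u a ≤ coneApex n B q a) {b : Fin (n + 1)}
    (hb : ∀ a : Fin (n + 1), (a : ℕ) < n → n ≤ B σ + a + 1 → a ≠ b → u a = 0)
    (hb1 : (b : ℕ) < n → u b ≤ 1) :
    LexBelow (coneApex n B q) u := by
  have hlt := coneApex_lt (n := n) (B := B) (j := σ) (j' := σ + 1) (a := n - 1 - B σ)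
    (Nat.lt_succ_self _) (by omega)
  have hle := coneApex_mono (n := n) (B := B) (show σ + 1 ≤ q by omega) (n - 1 - B σ)
  set τ : Fin (n + 1) := ⟨n - 1 - B σ, by omega⟩ with hτ
  have hbelow : ∀ a < τ, u a ≤ coneApex n B q a := by
    intro a ha
    rw [Fin.lt_def] at ha
    simp only [hτ] at ha
    exact hu a (by omega)
  by_cases hτu : u τ < coneApex n B q τ
  · exact lexBelow_of_le (by simp only [hτ]; omega) hbelow hτu
  have hτu' : coneApex n B q (n - 1 - B σ) ≤ u τ := not_lt.1 hτu
  have hτb : τ = b := by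
    by_contra hne
    have := hb τ (by simp only [hτ]; omega) (by simp only [hτ]; omega) hne
    omega
  rw [← hτb] at hb hb1
  have hu1 := hb1 (by simp only [hτ]; omega)
  have hval : coneApex n B q τ = coneApex n B q (n - 1 - B σ) := rfl
  have hB' := hB (Nat.le_add_right σ 1)
  rcases hB'.eq_or_lt with heq | hne
  · have hlt2 := coneApex_lt (n := n) (B := B) (j := σ + 1) (j' := q) (a := n - 1 - B σ)
      (by omega) (by omega)
    omega
  · have hlt2 := coneApex_lt (n := n) (B := B) (j := σ + 1) (j' := q) (a := n - 1 - B (σ + 1))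
      (by omega) (by omega)
    refine lexBelow_of_le (τ := ⟨n - 1 - B (σ + 1), by omega⟩) (by simp only; omega) (fun a ha => ?_)
      ?_
    · rw [Fin.lt_def] at ha
      simp only at ha
      rcases lt_trichotomy a τ with h | rfl | h
      · exact hbelow a h
      · change u τ ≤ coneApex n B q (n - 1 - B σ)
        omega
      · rw [Fin.lt_def] at h
        simp only [hτ] at h
        rw [hb a (by omega) (by omega) (by rw [Ne, Fin.ext_iff]; simp only [hτ]; omega)]
        exact Nat.zero_le _
    · rw [hb _ (by simp only; omega) (by simp only; omega)
        (by rw [Ne, Fin.ext_iff]; simp only [hτ]; omega)]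
      exact (Nat.zero_le _).trans_lt hlt2

lemma lexBelow_of_lt_altApex {u : Fin (n + 1) →₀ ℕ}
    (hle : ∀ a : Fin (n + 1), (a : ℕ) < n → u a ≤ altApex n σ B a)
    {b : Fin (n + 1)} (hbn : (b : ℕ) < n) (hb : u b < altApex n σ B b) :
    LexBelow (coneApex n B q) u := by
  have hα0 := coneApex_of_add_lt hB h1 h3 (a := 0) (by omega)
  rw [if_pos rfl] at hα0
  by_cases h0 : u 0 < σ
  · exact lexBelow_of_le (τ := 0) (by simp only [Fin.val_zero]; omega) (fun a ha => by simp at ha)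
      (by rw [Fin.val_zero, hα0]; exact h0)
  · have hb' := altApex_apply (n := n) (σ := σ) (B := B) b
    refine lexBelow_of_sum_le_one hB h2 h3 (b := Fin.last n) (fun a ha => ?_) (fun a han ha _ => ?_)
      (fun h => by simp at h)
    · rw [coneApex_of_add_lt hB h1 h3 ha]
      have h4 := hle a (by omega)
      rw [altApex_apply] at h4
      by_cases ha0 : (a : ℕ) = 0
      · have ha0' : a = 0 := Fin.ext ha0
        subst ha0'
        by_cases hb0 : b = 0
        · subst hb0
          split_ifs at * <;> omega
        · have : (b : ℕ) ≠ 0 := fun h => hb0 (Fin.ext h)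
          split_ifs at * <;> omega
      · by_cases hab : a = b
        · subst hab
          split_ifs at * <;> omega
        · by_cases hb0 : b = 0
          · subst hb0
            split_ifs at * <;> omega
          · have : (b : ℕ) ≠ 0 := fun h => hb0 (Fin.ext h)
            have : (a : ℕ) ≠ b := fun h => hab (Fin.ext h)
            split_ifs at * <;> omega
    · have h4 := hle a han
      rw [altApex_apply] at h4
      split_ifs at * <;> omega

lemma lexBelow_of_move_altApex {u : Fin (n + 1) →₀ ℕ} {i j : Fin (n + 1)} (hij : i < j)
    (hu : ∀ a : Fin (n + 1), (a : ℕ) < n →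
      (u + Finsupp.single i 1 : Fin (n + 1) →₀ ℕ) a = altApex n σ B a) :
    LexBelow (coneApex n B q) (u + Finsupp.single j 1) := by
  have hin : (i : ℕ) < n := by
    rw [Fin.lt_def] at hij
    omega
  have hi := hu i hin
  have hu' : ∀ a : Fin (n + 1), (a : ℕ) < n → a ≠ i → u a = altApex n σ B a := by
    intro a ha hai
    rw [← hu a ha]
    simp [hai.symm]
  rw [Finsupp.add_apply, Finsupp.single_eq_same] at hi
  by_cases hjn : (j : ℕ) < n
  swap
  · have hne : ∀ a : Fin (n + 1), (a : ℕ) < n →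
        (u + Finsupp.single j 1 : Fin (n + 1) →₀ ℕ) a = u a := by
      intro a ha
      have : j ≠ a := by
        rintro rfl
        exact hjn ha
      simp [this]
    refine lexBelow_of_lt_altApex hB h1 h2 h3 (fun a ha => ?_) hin (by rw [hne i hin]; omega)
    rw [hne a ha]
    rcases eq_or_ne a i with rfl | hai
    · omega
    · exact (hu' a ha hai).le
  set v : Fin (n + 1) →₀ ℕ := u + Finsupp.single j 1 with hv
  have hvj : v j = altApex n σ B j + 1 := by
    rw [hv, Finsupp.add_apply, Finsupp.single_eq_same, hu' j hjn hij.ne']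
  have hva : ∀ a, a ≠ j → v a = u a := by
    intro a ha
    simp [hv, ha.symm]
  have hi' := altApex_apply (n := n) (σ := σ) (B := B) i
  have hj' := altApex_apply (n := n) (σ := σ) (B := B) j
  have hj0 : (0 : Fin (n + 1)) ≠ j := ((Fin.zero_le i).trans_lt hij).ne
  rw [Fin.lt_def] at hij
  by_cases h0 : v 0 < σ
  · refine lexBelow_of_le (τ := 0) (by simp only [Fin.val_zero]; omega) (fun a ha => by simp at ha) ?_
    rw [Fin.val_zero, coneApex_of_add_lt hB h1 h3 (by omega), if_pos rfl]
    exact h0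
  have him : (i : ℕ) = n - 2 - B σ := by
    by_contra hne
    rw [if_neg hne, add_zero] at hi'
    split_ifs at hi' with hi0
    · have hi0' : i = 0 := Fin.ext hi0
      subst hi0'
      rw [hva 0 hj0] at h0
      omega
    · omega
  refine lexBelow_of_sum_le_one hB h2 h3 (b := j) (fun a ha => ?_) (fun a han ha haj => ?_)
      (fun _ => ?_)
  · rw [coneApex_of_add_lt hB h1 h3 ha, hva a (by rintro rfl; omega)]
    rcases eq_or_ne a i with rfl | hai
    · rw [if_pos him] at hi'
      omega
    · have hne : (a : ℕ) ≠ i := fun h => hai (Fin.ext h)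
      rw [hu' a (by omega) hai, altApex_apply, if_neg (by omega : ¬ (a : ℕ) = n - 2 - B σ), add_zero]
  · have hne : (a : ℕ) ≠ i := by omega
    rw [hva a haj, hu' a han (fun h => hne (by rw [h])), altApex_apply, if_neg (by omega),
      if_neg (by omega)]
  · rw [hvj, hj', if_neg (by omega), if_neg (by omega)]

lemma isSatBorelSet_altSet : IsSatBorelSet (altSet n σ q B) where
  add_mem := by
    rintro u ⟨hu1, hu2⟩ w
    refine ⟨(isSatBorelSet_lexBelow n _).add_mem u hu1 w, fun h => hu1 ?_⟩
    push Not at hu2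
    obtain ⟨b, hbn, hb⟩ := hu2
    have hle : ∀ a : Fin (n + 1), (a : ℕ) < n → u a ≤ altApex n σ B a := fun a ha => by
      rw [← h a ha]
      exact Nat.le_add_right _ _
    exact lexBelow_of_lt_altApex hB h1 h2 h3 hle hbn (lt_of_le_of_ne (hle b hbn) hb)
  borel := by
    rintro u i j hij ⟨hu1, -⟩
    exact ⟨(isSatBorelSet_lexBelow n _).borel u i j hij hu1,
      fun h => hu1 (lexBelow_of_move_altApex hB h1 h2 h3 hij h)⟩
  sat := by
    rintro u ⟨hu1, hu2⟩
    refine ⟨(isSatBorelSet_lexBelow n _).sat u hu1, fun h => hu2 fun a ha => ?_⟩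
    rw [← h a ha, Finsupp.add_apply, Finsupp.single_apply, if_neg, add_zero]
    rintro rfl
    simp at ha

lemma not_lexBelow_of_eq_altApex {u : Fin (n + 1) →₀ ℕ}
    (hu : ∀ a : Fin (n + 1), (a : ℕ) < n → u a = altApex n σ B a) :
    ¬ LexBelow (coneApex n B q) u := by
  rintro ⟨τ, hτ, h, hlt⟩
  have key : ∀ a : Fin (n + 1), B σ + a + 1 < n →
      (u a = coneApex n B q a + if (a : ℕ) = n - 2 - B σ then 1 else 0) := by
    intro a ha
    rw [hu a (by omega), altApex_apply, coneApex_of_add_lt hB h1 h3 ha]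
  by_cases hτσ : B σ + τ + 1 < n
  · have := key τ hτσ
    omega
  · have h4 := key ⟨n - 2 - B σ, by omega⟩ (by simp only; omega)
    rw [h ⟨n - 2 - B σ, by omega⟩ (by rw [Fin.lt_def]; simp only; omega), if_pos rfl] at h4
    omega

lemma complCount_altSet (hq : B q = 0) {t : ℕ} (ht : q ≤ t) :
    (complCount (altSet n σ q B) t : ℚ) =
      (∑ j ∈ Finset.range (q + 1), gotzmannTerm (B j) j).eval (t : ℚ) := by
  have hn : B 0 < n := by
    rcases Nat.eq_zero_or_pos σ with rfl | hσ
    · omega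
    · have := h1 0 hσ
      omega
  have hdeg : (altApex n σ B).degree = σ + 1 := by
    rw [altApex, map_add, Finsupp.degree_single, Finsupp.degree_single]
  have hBn : ∀ j, B j ≤ B 0 := fun j => hB (Nat.zero_le j)
  rw [complCount_eq_of_cones (q := q + 1) (c := fun j => n - B j)
    (m := fun j => if j = q then altApex n σ B else apexVec n B j)]
  · rw [Polynomial.eval_finsetSum, Nat.cast_sum]
    refine Finset.sum_congr rfl fun j hj => ?_
    rw [Finset.mem_range] at hj
    have h5 : n - (n - B j) = B j := by
      have := hBn j
      omega
    simp only [h5]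
    split_ifs with hjq
    · subst hjq
      rw [hq]
      simp [gotzmannTerm, polyBinom_zero]
    · rw [degree_apexVec hB hn, gotzmannTerm_eval (by omega)]
  · intro j _
    exact Nat.sub_le _ _
  · intro j hj a ha
    split_ifs at ha with hjq
    · rw [altApex_apply] at ha
      rw [hjq, hq]
      split_ifs at ha <;> omega
    · have := add_lt_of_apexVec_ne_zero hB ha
      omega
  · intro j hj
    split_ifs with hjq
    · rw [hdeg]
      omega
    · rw [degree_apexVec hB hn]
      omega
  · have hlast : ∀ i < q, ∀ u : Fin (n + 1) →₀ ℕ,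
        (∀ a : Fin (n + 1), (a : ℕ) < n - B i → u a = apexVec n B i a) →
        (∀ a : Fin (n + 1), (a : ℕ) < n - B q → u a = altApex n σ B a) → False := by
      intro i hi u h h'
      refine not_lexBelow_of_eq_altApex hB h1 h2 h3 (fun a ha => h' a (by omega))
        ((exists_inCone_iff hB hn u).1 ⟨i, hi, fun a ha => ?_⟩)
      rw [h a (by omega), apexVec_apply]
    intro i hi j hj u h h'
    split_ifs at h h' with hiq hjq hjq
    · rw [hiq, hjq]
    · rw [hiq] at h
      exact (hlast j (by omega) u h' h).elim
    · rw [hjq] at h'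
      exact (hlast i (by omega) u h h').elim
    · refine inCone_injective hB hn (u := u) (fun a ha => ?_) (fun a ha => ?_)
      · rw [h a (by omega), apexVec_apply]
      · rw [h' a (by omega), apexVec_apply]
  · intro u
    simp only [altSet, Set.mem_ofPred_eq, not_and_or, not_not, Nat.lt_succ_iff_lt_or_eq, or_and_right,
      exists_or, exists_eq_left]
    refine or_congr ?_ ?_
    · rw [← exists_inCone_iff hB hn]
      refine exists_congr fun j => and_congr_right fun hj => forall_congr' fun a => ?_
      rw [if_neg hj.ne, apexVec_apply]
      exact imp_congr_left (by omega)
    · simp [hq]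

omit h1 in
lemma exists_mem_altSet_lexBelow (hn : B 0 < n) :
    ∃ u ∈ altSet n σ q B, LexBelow (coneApex n B (q + 1)) u := by
  have hcone : InCone B q (apexVec n B q) := fun a _ => apexVec_apply q a
  refine ⟨apexVec n B q, ⟨fun h => ?_, fun h => ?_⟩,
    (exists_inCone_iff hB hn _).1 ⟨q, Nat.lt_succ_self q, hcone⟩⟩
  · obtain ⟨j, hj, hj'⟩ := (exists_inCone_iff hB hn _).2 h
    exact hj.ne (inCone_injective hB hn hj' hcone)
  · have heq : apexVec n B q = altApex n σ B := by
      ext a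
      by_cases ha : (a : ℕ) < n
      · exact h a ha
      · rw [altApex_apply, if_neg (by omega), if_neg (by omega)]
        by_contra hne
        have := add_lt_of_apexVec_ne_zero hB hne
        omega
    have h4 := congrArg Finsupp.degree heq
    rw [degree_apexVec hB hn, altApex, map_add, Finsupp.degree_single, Finsupp.degree_single] at h4
    omega

end Modification

section Ideals

open MvPolynomial

variable {k : Type*} [Field k]

/-- The exponents of the monomials in an ideal. -/
def expSet {N : ℕ} (I : Ideal (MvPolynomial (Fin N) k)) : Set (Fin N →₀ ℕ) :=
  {u | monomial u (1 : k) ∈ I}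

lemma IsMonomialIdeal.mem_iff {N : ℕ} {I : Ideal (MvPolynomial (Fin N) k)} (hI : IsMonomialIdeal I)
    {f : MvPolynomial (Fin N) k} : f ∈ I ↔ ∀ u ∈ f.support, u ∈ expSet I := by
  obtain ⟨S, rfl⟩ := hI
  rw [mem_ideal_span_monomial_image]
  refine forall₂_congr fun u _ => ?_
  rw [expSet, Set.mem_ofPred_eq, mem_ideal_span_monomial_image]
  simp

lemma IsMonomialIdeal.ext {N : ℕ} {I J : Ideal (MvPolynomial (Fin N) k)} (hI : IsMonomialIdeal I)
    (hJ : IsMonomialIdeal J) (h : expSet I = expSet J) : I = J := by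
  ext f
  rw [hI.mem_iff, hJ.mem_iff, h]

lemma hilbFn_eq_complCount {n : ℕ} {I : Ideal (MvPolynomial (Fin (n + 1)) k)}
    (hI : IsMonomialIdeal I) (t : ℕ) : hilbFn I t = complCount (expSet I) t := by
  classical
  set F := (Finset.univ.finsuppAntidiag t).filter (· ∉ expSet I) with hF
  have hcard : complCount (expSet I) t = F.card := by
    rw [complCount, hF]
  let φ : homogeneousSubmodule (Fin (n + 1)) k t →ₗ[k] (F → k) :=
    LinearMap.pi fun u => lcoeff k (u : Fin (n + 1) →₀ ℕ) ∘ₗ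
      (homogeneousSubmodule (Fin (n + 1)) k t).subtype
  have hφ : ∀ f u, φ f u = coeff (u : Fin (n + 1) →₀ ℕ) (f : MvPolynomial (Fin (n + 1)) k) :=
    fun f u => rfl
  have hker : LinearMap.ker φ = Submodule.comap (homogeneousSubmodule (Fin (n + 1)) k t).subtype
      (Submodule.restrictScalars k I) := by
    ext f
    rw [LinearMap.mem_ker, Submodule.mem_comap, Submodule.subtype_apply,
      Submodule.restrictScalars_mem, hI.mem_iff]
    constructor
    · intro h u hu
      by_contra hu'
      have hdeg : u.degree = t := by
        have := (mem_homogeneousSubmodule _ _).1 f.2 (mem_support_iff.1 hu)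
        rwa [Finsupp.degree_eq_weight_one]
      have hmem : u ∈ F := Finset.mem_filter.2 ⟨mem_finsuppAntidiag_univ.2 hdeg, hu'⟩
      exact mem_support_iff.1 hu (by rw [← hφ f ⟨u, hmem⟩, h]; rfl)
    · intro h
      ext u
      rw [hφ]
      by_contra hne
      exact (Finset.mem_filter.1 u.2).2 (h u (mem_support_iff.2 hne))
  have hsurj : Function.Surjective φ := by
    intro g
    refine ⟨⟨∑ u : F, monomial (u : Fin (n + 1) →₀ ℕ) (g u), Submodule.sum_mem _ fun u _ => ?_⟩, ?_⟩
    · rw [mem_homogeneousSubmodule]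
      exact isHomogeneous_monomial _ (mem_finsuppAntidiag_univ.1 (Finset.mem_filter.1 u.2).1)
    · ext v
      rw [hφ]
      simp only [coeff_sum, coeff_monomial]
      rw [Finset.sum_eq_single v]
      · simp
      · intro u _ huv
        rw [if_neg fun h => huv (Subtype.ext h)]
      · simp
  rw [hcard, hilbFn, ← hker, (LinearMap.quotKerEquivOfSurjective φ hsurj).finrank_eq,
    Module.finrank_fintype_fun_eq_card, Fintype.card_coe]

lemma isSatBorelSet_expSet {n : ℕ} {I : Ideal (MvPolynomial (Fin (n + 1)) k)}
    (hB : IsBorel I) (hS : IsSaturatedIdeal I) : IsSatBorelSet (expSet I) := by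
  have hborel : ∀ u, ∀ i j : Fin (n + 1), i < j → u + Finsupp.single j 1 ∈ expSet I →
      u + Finsupp.single i 1 ∈ expSet I := by
    intro u i j hij hu
    have h := hB _ hu j (by simp) i hij
    rwa [add_tsub_cancel_right] at h
  refine ⟨fun u hu w => ?_, hborel, fun u hu => hS _ ⟨1, le_rfl, fun g hg => ?_⟩⟩
  · have : monomial (u + w) (1 : k) = monomial w 1 * monomial u 1 := by
      rw [monomial_mul, one_mul, add_comm u w]
    rw [expSet, Set.mem_ofPred_eq, this]
    exact I.mul_mem_left _ hu
  · rw [pow_one] at hg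
    have hle : Ideal.span (Set.range (X : Fin (n + 1) → MvPolynomial (Fin (n + 1)) k)) ≤
        Submodule.comap (LinearMap.mulLeft (MvPolynomial (Fin (n + 1)) k) (monomial u (1 : k))) I := by
      rw [Ideal.span_le]
      rintro _ ⟨j, rfl⟩
      change monomial u (1 : k) * X j ∈ I
      rw [X, monomial_mul, one_mul]
      rcases (Fin.le_last j).eq_or_lt with rfl | hj
      · exact hu
      · exact hborel u j _ hj hu
    exact hle hg

variable (k) in
/-- The monomial ideal spanned by the monomials with exponents in `S`. -/
noncomputable def idealOfExps {N : ℕ} (S : Set (Fin N →₀ ℕ)) : Ideal (MvPolynomial (Fin N) k) :=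
  Ideal.span ((fun u => monomial u (1 : k)) '' S)

lemma expSet_idealOfExps {n : ℕ} {S : Set (Fin (n + 1) →₀ ℕ)} (hS : IsSatBorelSet S) :
    expSet (idealOfExps k S) = S := by
  ext u
  rw [expSet, Set.mem_ofPred_eq, idealOfExps, mem_ideal_span_monomial_image]
  simp only [mem_support_iff, coeff_monomial, ne_eq, ite_eq_right_iff, one_ne_zero, imp_false,
    not_not, forall_eq']
  exact ⟨fun ⟨v, hv, h⟩ => hS.mem_of_le hv h, fun h => ⟨u, h, le_rfl⟩⟩

lemma isMonomialIdeal_idealOfExps {N : ℕ} (S : Set (Fin N →₀ ℕ)) :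
    IsMonomialIdeal (idealOfExps k S) := ⟨S, rfl⟩

lemma isBorel_idealOfExps {n : ℕ} {S : Set (Fin (n + 1) →₀ ℕ)} (hS : IsSatBorelSet S) :
    IsBorel (idealOfExps k S) := by
  intro u hu j hj i hij
  change _ ∈ expSet (idealOfExps k S)
  change _ ∈ expSet (idealOfExps k S) at hu
  rw [expSet_idealOfExps hS] at hu ⊢
  refine hS.borel _ i j hij ?_
  rwa [tsub_add_cancel_of_le]
  rw [Finsupp.single_le_iff]
  omega

lemma isSaturatedIdeal_idealOfExps {n : ℕ} {S : Set (Fin (n + 1) →₀ ℕ)} (hS : IsSatBorelSet S) :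
    IsSaturatedIdeal (idealOfExps k S) := by
  rintro f ⟨j, -, hj⟩
  have hmon := isMonomialIdeal_idealOfExps (k := k) S
  have h := hj (X (Fin.last n) ^ j) (Ideal.pow_mem_pow (Ideal.subset_span (Set.mem_range_self _)) j)
  rw [hmon.mem_iff, expSet_idealOfExps hS] at h ⊢
  intro u hu
  have hmem : u + Finsupp.single (Fin.last n) j ∈ S := by
    refine h _ ?_
    rw [mem_support_iff, X_pow_eq_monomial, coeff_mul_monomial, mul_one]
    exact mem_support_iff.1 hu
  clear hu h hj
  induction j with
  | zero => simpa using hmem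
  | succ j ih =>
    rw [Finsupp.single_add, ← add_assoc] at hmem
    exact ih (hS.sat _ hmem)

lemma lexExp_le_iff {n : ℕ} (hn : 0 < n) (a : ℕ → ℕ) (u : Fin (n + 1) →₀ ℕ) :
    (∃ m < n, lexExp n a m ≤ u) ↔ ¬ LexBelow (fun i => a (n - 1 - i)) u := by
  have hexp : ∀ m (t : Fin (n + 1)), lexExp n a m t = if (t : ℕ) < m then a (n - 1 - (t : ℕ))
    else if (t : ℕ) = m then (if m = n - 1 then a 0 else a (n - 1 - m) + 1) else 0 := fun _ _ => rfl
  constructor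
  · rintro ⟨m, hm, hle⟩ ⟨τ, hτ, h, hlt⟩
    beta_reduce at h hlt
    rcases lt_trichotomy (τ : ℕ) m with hτm | hτm | hτm
    · have h1 := hle τ
      rw [hexp, if_pos hτm] at h1
      omega
    · have h1 := hle τ
      rw [hexp, if_neg hτm.not_lt, if_pos hτm, ← hτm] at h1
      split_ifs at h1 with h2
      · rw [h2, Nat.sub_self] at hlt
        omega
      · omega
    · have h1 := hle ⟨m, by omega⟩
      rw [hexp, if_neg (by simp), if_pos rfl, if_neg (by omega),
        h ⟨m, by omega⟩ (Fin.lt_def.2 hτm)] at h1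
      dsimp only at h1
      omega
  · intro h
    by_cases hex : ∃ t : Fin (n + 1), (t : ℕ) < n ∧ u t ≠ a (n - 1 - t)
    · have hfin : {t : Fin (n + 1) | (t : ℕ) < n ∧ u t ≠ a (n - 1 - t)}.Finite := Set.toFinite _
      obtain ⟨m, ⟨hmn, hne⟩, hmin⟩ := hfin.exists_minimal hex
      have heq : ∀ t < m, u t = a (n - 1 - t) := by
        intro t ht
        by_contra hne'
        exact absurd (hmin ⟨(Fin.lt_def.1 ht).trans hmn, hne'⟩ ht.le) (not_le.2 ht)
      have hlt : ¬ u m < a (n - 1 - m) := fun hlt => h ⟨m, hmn, heq, hlt⟩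
      refine ⟨m, hmn, fun t => ?_⟩
      rw [hexp]
      split_ifs with h1 h2 h3
      · exact (heq t (Fin.lt_def.2 h1)).ge
      · rw [Fin.ext h2]
        rw [h3, Nat.sub_self] at hlt
        omega
      · rw [Fin.ext h2]
        omega
      · exact Nat.zero_le _
    · push Not at hex
      refine ⟨n - 1, by omega, fun t => ?_⟩
      rw [hexp, if_pos (rfl : n - 1 = n - 1)]
      split_ifs with h1 h2
      · exact (hex t (by omega)).ge
      · rw [hex t (by omega), h2, Nat.sub_self]
      · exact Nat.zero_le _

lemma expSet_lexIdealGen {n : ℕ} (hn : 0 < n) (a : ℕ → ℕ) : expSet (lexIdealGen k n a) =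
    {u | ¬ LexBelow (fun i => a (n - 1 - i)) u} := by
  ext u
  rw [Set.mem_ofPred_eq, ← lexExp_le_iff hn, expSet, Set.mem_ofPred_eq, lexIdealGen,
    ← Set.image_image (g := fun u => monomial u (1 : k)), mem_ideal_span_monomial_image]
  simp

lemma isMonomialIdeal_lexIdealGen (n : ℕ) (a : ℕ → ℕ) : IsMonomialIdeal (lexIdealGen k n a) :=
  ⟨lexExp n a '' {m | m < n}, by rw [lexIdealGen, Set.image_image]⟩

end Ideals

lemma eExt_eq_countGE {B : ℕ → ℕ} (hB : Antitone B) {r : ℕ} {e : Fin (B 0 + 1) → ℤ}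
    (he : ∀ i, 0 ≤ e i) (h : mhSum (B 0) e = ∑ j ∈ Finset.range r, gotzmannTerm (B j) j) (i : ℕ) :
    eExt (B 0) e i = countGE B r i := by
  lift e to Fin (B 0 + 1) → ℕ using he
  have key : ∀ i < B 0 + 1,
      (if h : i < B 0 + 1 then e ⟨i, h⟩ else 0) = countGE B r i := by
    refine macaulay_sum_injective _ _ _ ?_
    rw [← gotzmann_sum_eq_macaulay_sum hB, ← h, mhSum, Finset.sum_range]
    refine Finset.sum_congr rfl fun i _ => ?_
    rw [dif_pos i.2, Fin.eta, ← polyBinom_sub_eq_sum]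
  unfold eExt
  split_ifs with hi
  · have := key i (Nat.lt_succ_of_le hi)
    rw [dif_pos (Nat.lt_succ_of_le hi)] at this
    simpa using this
  · rw [countGE_eq_zero hB (not_le.1 hi), Nat.cast_zero]

lemma countGE_sub_countGE_succ (B : ℕ → ℕ) (r i : ℕ) :
    countGE B r i - countGE B r (i + 1) = ((Finset.range r).filter fun j => B j = i).card := by
  rw [countGE, countGE, ← Finset.card_sdiff_of_subset
    (Finset.monotone_filter_right _ fun j _ hj => (Nat.le_succ i).trans hj)]
  congr 1
  ext j
  simp only [Finset.mem_sdiff, Finset.mem_filter, Finset.mem_range]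
  omega

lemma aSeq_eq_coneApex {B : ℕ → ℕ} (hB : Antitone B) {r : ℕ} {e : Fin (B 0 + 1) → ℤ}
    (he : ∀ i, 0 ≤ e i) (h : mhSum (B 0) e = ∑ j ∈ Finset.range r, gotzmannTerm (B j) j)
    {n i : ℕ} (hi : i < n) : aSeq (B 0) e (n - 1 - i) = coneApex n B r i := by
  rw [aSeq, eExt_eq_countGE hB he h, eExt_eq_countGE hB he h, ← Nat.cast_sub
    (countGE_antitone B r (Nat.le_succ _)), Int.toNat_natCast, countGE_sub_countGE_succ, coneApex]
  congr 1
  ext j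
  simp only [Finset.mem_filter, Finset.mem_range]
  omega

lemma LexBelow.congr {n : ℕ} {α β : ℕ → ℕ} (h : ∀ i < n, α i = β i) {u : Fin (n + 1) →₀ ℕ}
    (hu : LexBelow α u) : LexBelow β u := by
  obtain ⟨τ, hτ, heq, hlt⟩ := hu
  exact ⟨τ, hτ, fun a ha => (heq a ha).trans (h a ((Fin.lt_def.1 ha).trans hτ)), h τ hτ ▸ hlt⟩

lemma expSet_lexIdealGen_aSeq {k : Type*} [Field k] {B : ℕ → ℕ} (hB : Antitone B) {r : ℕ}
    {e : Fin (B 0 + 1) → ℤ} (he : ∀ i, 0 ≤ e i)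
    (h : mhSum (B 0) e = ∑ j ∈ Finset.range r, gotzmannTerm (B j) j) {n : ℕ} (hn : 0 < n) :
    expSet (lexIdealGen k n (aSeq (B 0) e)) = {u | ¬ LexBelow (coneApex n B r) u} := by
  rw [expSet_lexIdealGen hn]
  ext u
  exact not_congr ⟨LexBelow.congr fun i hi => aSeq_eq_coneApex hB he h hi,
    LexBelow.congr fun i hi => (aSeq_eq_coneApex hB he h hi).symm⟩

lemma exists_ne_lexIdealGen (k : Type*) [Field k] {B : ℕ → ℕ} (hB : Antitone B) {q σ n : ℕ}
    {e : Fin (B 0 + 1) → ℤ} (he : ∀ i, 0 ≤ e i)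
    (h : mhSum (B 0) e = ∑ j ∈ Finset.range (q + 1), gotzmannTerm (B j) j) (hn : B 0 < n)
    (h1 : ∀ j < σ, B j + 1 = n) (h2 : B σ + 2 ≤ n) (h3 : σ + 2 ≤ q) (hq : B q = 0) :
    ∃ I : Ideal (MvPolynomial (Fin (n + 1)) k),
      IsMonomialIdeal I ∧ IsBorel I ∧ IsSaturatedIdeal I ∧
      (∃ N : ℕ, ∀ i : ℕ, N ≤ i → (hilbFn I i : ℚ)
        = (∑ j ∈ Finset.range (q + 1), gotzmannTerm (B j) j).eval (i : ℚ)) ∧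
      I ≠ lexIdealGen k n (aSeq (B 0) e) := by
  have hS := isSatBorelSet_altSet hB h1 h2 h3
  refine ⟨idealOfExps k (altSet n σ q B), isMonomialIdeal_idealOfExps _, isBorel_idealOfExps hS,
    isSaturatedIdeal_idealOfExps hS, ⟨q, fun t ht => ?_⟩, fun heq => ?_⟩
  · rw [hilbFn_eq_complCount (isMonomialIdeal_idealOfExps _), expSet_idealOfExps hS]
    exact complCount_altSet hB h1 h2 h3 hq ht
  · obtain ⟨u, hu, hlex⟩ := exists_mem_altSet_lexBelow hB h2 h3 hn
    rw [← expSet_idealOfExps (k := k) hS, heq,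
      expSet_lexIdealGen_aSeq hB he h (Nat.zero_lt_of_lt hn)] at hu
    exact hu hlex

lemma eq_lexIdealGen {k : Type*} [Field k] {B : ℕ → ℕ} (hB : Antitone B) {r n : ℕ}
    {e : Fin (B 0 + 1) → ℤ} (he : ∀ i, 0 ≤ e i)
    (h : mhSum (B 0) e = ∑ j ∈ Finset.range r, gotzmannTerm (B j) j) (hn : B 0 < n)
    (hcond : countGE B r 1 = r ∨ r ≤ 2 ∨ (B 0 + 1 = n ∧ r ≤ countGE B r (B 0) + 2))
    {I : Ideal (MvPolynomial (Fin (n + 1)) k)} (hI : IsMonomialIdeal I) (hIB : IsBorel I)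
    (hIS : IsSaturatedIdeal I) (hilb : ∃ N : ℕ, ∀ i : ℕ, N ≤ i → (hilbFn I i : ℚ)
      = (∑ j ∈ Finset.range r, gotzmannTerm (B j) j).eval (i : ℚ)) :
    I = lexIdealGen k n (aSeq (B 0) e) := by
  refine hI.ext (isMonomialIdeal_lexIdealGen _ _) ?_
  rw [expSet_lexIdealGen_aSeq hB he h (Nat.zero_lt_of_lt hn)]
  ext u
  rw [Set.mem_ofPred_eq, ← exists_inCone_iff hB hn, ← (isSatBorelSet_expSet hIB hIS).notMem_iff_inCone
    hB hn ?_ hcond, not_not]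
  simpa only [hilbFn_eq_complCount hI] using hilb

lemma exists_antitone_extension {r : ℕ} {b : Fin r → ℕ} (hb : Antitone b) :
    ∃ B : ℕ → ℕ, Antitone B ∧ ∀ j : Fin r, b j = B j := by
  refine ⟨fun j => if h : j < r then b ⟨j, h⟩ else 0, fun i j hij => ?_, fun j => by simp⟩
  dsimp only
  split_ifs with h1 h2 h2
  · exact hb hij
  · omega
  · exact Nat.zero_le _
  · exact le_rfl

lemma card_filter_fin_eq_countGE {B : ℕ → ℕ} (hB : Antitone B) (r : ℕ) :
    ((Finset.univ : Finset (Fin r)).filter fun j : Fin r => B j = B 0).card = countGE B r (B 0) := by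
  have h : countGE B r (B 0) = ((Finset.range r).filter fun j => B j = B 0).card := by
    rw [← countGE_sub_countGE_succ, countGE_eq_zero hB (Nat.lt_succ_self _), Nat.sub_zero]
  rw [h, Finset.card_filter, Finset.card_filter, Finset.sum_range]

lemma countGE_one_eq {B : ℕ → ℕ} (hB : Antitone B) {r : ℕ} (hr : 0 < r) (h : 0 < B (r - 1)) :
    countGE B r 1 = r := by
  refine le_antisymm ((Finset.card_filter_le _ _).trans_eq (Finset.card_range r)) ?_
  have := (lt_countGE_iff hB (r := r) (i := 1) (j := r - 1)).2 ⟨by omega, h⟩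
  omega

/-- Classification of Hilbert polynomials whose lexicographic ideal is the unique
saturated Borel monomial ideal of codimension `c`.  Here `p` is the admissible Hilbert
polynomial with Gotzmann partition `b_1 ≥ … ≥ b_r ≥ 0` (0-indexed as `b : Fin r → ℕ`),
with matching Macaulay–Hartshorne partition `e_0 ≥ … ≥ e_d > 0` where `d = b_1`,
`n = c + b_1`, and `s` is the number of indices `j` with `b_j = b_1`. -/
theorem statement_18 (k : Type*) [Field k] (c r : ℕ) (hc : 1 ≤ c) (hr : 0 < r)
    (b : Fin r → ℕ) (hb : Antitone b)
    (e : Fin (b ⟨0, hr⟩ + 1) → ℤ) (he : Antitone e) (hepos : ∀ i, 0 < e i)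
    (hpe : mhSum (b ⟨0, hr⟩) e
      = ∑ j : Fin r, polyBinom ((b j : ℤ) - ((j : ℕ) : ℤ)) (b j))
    (n : ℕ) (hn : n = c + b ⟨0, hr⟩) :
    (∀ I : Ideal (MvPolynomial (Fin (n + 1)) k),
        IsMonomialIdeal I → IsBorel I → IsSaturatedIdeal I →
        (∃ N : ℕ, ∀ i : ℕ, N ≤ i → (hilbFn I i : ℚ)
          = (∑ j : Fin r, polyBinom ((b j : ℤ) - ((j : ℕ) : ℤ)) (b j)).eval (i : ℚ)) →
        I = lexIdealGen k n (aSeq (b ⟨0, hr⟩) e))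
      ↔ ((2 ≤ c ∧ (0 < b ⟨r - 1, by omega⟩ ∨ r ≤ 2)) ∨
         (c = 1 ∧ (0 < b ⟨r - 1, by omega⟩ ∨ b ⟨0, hr⟩ = b ⟨r - 1, by omega⟩ ∨
           r - (Finset.univ.filter fun j => b j = b ⟨0, hr⟩).card ≤ 2))) := by
  obtain ⟨B, hB, hbB⟩ := exists_antitone_extension hb
  obtain rfl : b = fun j : Fin r => B j := funext hbB
  have he0 : ∀ i, 0 ≤ e i := fun i => (hepos i).le
  have hsum : ∑ j : Fin r, polyBinom ((B j : ℤ) - ((j : ℕ) : ℤ)) (B j)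
      = ∑ j ∈ Finset.range r, gotzmannTerm (B j) j :=
    (Finset.sum_range fun j => gotzmannTerm (B j) j).symm
  beta_reduce
  rw [hsum] at hpe ⊢
  change n = c + B 0 at hn
  change _ ↔ ((2 ≤ c ∧ (0 < B (r - 1) ∨ r ≤ 2)) ∨ (c = 1 ∧ (0 < B (r - 1) ∨ B 0 = B (r - 1) ∨
    r - ((Finset.univ : Finset (Fin r)).filter fun j : Fin r => B j = B 0).card ≤ 2)))
  rw [card_filter_fin_eq_countGE hB]
  constructor
  · intro huniq
    by_contra hnot
    have hq : B (r - 1) = 0 := by omega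
    obtain ⟨σ, h1, h2, h3⟩ : ∃ σ, (∀ j < σ, B j + 1 = n) ∧ B σ + 2 ≤ n ∧ σ + 2 ≤ r - 1 := by
      rcases hc.eq_or_lt with rfl | hc2
      · have hlt : countGE B r (B 0) < r := by omega
        have hσ := (lt_countGE_iff hB (r := r) (i := B 0)).not.1 (lt_irrefl (countGE B r (B 0)))
        refine ⟨countGE B r (B 0), fun j hj => ?_, by omega, by omega⟩
        have := ((lt_countGE_iff hB).1 hj).2
        have := hB (Nat.zero_le j)
        omega
      · exact ⟨0, fun j hj => absurd hj (Nat.not_lt_zero j), by omega, by omega⟩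
    obtain ⟨q, rfl⟩ : ∃ q, r = q + 1 := ⟨r - 1, by omega⟩
    obtain ⟨I, hI, hIB, hIS, hilb, hne⟩ := exists_ne_lexIdealGen k hB he0 hpe (by omega) h1 h2 h3 hq
    exact hne (huniq I hI hIB hIS hilb)
  · intro hcond I hI hIB hIS hilb
    refine eq_lexIdealGen hB he0 hpe (by omega) ?_ hI hIB hIS hilb
    rcases hcond with ⟨-, h | h⟩ | ⟨rfl, h | h | h⟩
    · exact Or.inl (countGE_one_eq hB hr h)
    · exact Or.inr (Or.inl h)
    · exact Or.inl (countGE_one_eq hB hr h)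
    · have := (lt_countGE_iff hB (r := r) (i := B 0) (j := r - 1)).2 ⟨by omega, h.le⟩
      exact Or.inr (Or.inr ⟨by omega, by omega⟩)
    · exact Or.inr (Or.inr ⟨by omega, by omega⟩)
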